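/- Let b>0. Assume f satisfies (A1) and (A3) with exponent β, and g satisfies (A2) with exponent α, where α<1 and β ≥ 1/(1−α). If u₀∈C((−b,b)) satisfies inf_{x∈(−b,b)} u₀(x) > −∞, then there is no viscosity solution u:(−b,b)×[0,∞)→ℝ of the initial value problem u_t − f(g(u_x)u_{xx}) = 0 in Q, with the singular Dirichlet condition lim_{x→±b}u(x,t)=∞ for t>0, and initial datum u₀. -/

import Mathlib

open Filter Set Topology

noncomputable section

/-- The parabolic cylinder `Q = (-b,b) × (0,∞)`. -/
def Qset (b : ℝ) : Set (ℝ × ℝ) := Ioo (-b) b ×ˢ Ioi (0:ℝ)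

/-- The cylinder `Q₀ = (-b,b) × [0,∞)`. -/
def Q0set (b : ℝ) : Set (ℝ × ℝ) := Ioo (-b) b ×ˢ Ici (0:ℝ)

/-- Partial derivative in time. -/
def pT (φ : ℝ × ℝ → ℝ) (p : ℝ × ℝ) : ℝ := deriv (fun t => φ (p.1, t)) p.2

/-- Partial derivative in space. -/
def pX (φ : ℝ × ℝ → ℝ) (p : ℝ × ℝ) : ℝ := deriv (fun x => φ (x, p.2)) p.1

/-- Second partial derivative in space. -/
def pXX (φ : ℝ × ℝ → ℝ) (p : ℝ × ℝ) : ℝ := deriv (fun x => pX φ (x, p.2)) p.1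

/-- (A1): `f` is continuous, strictly increasing, `f 0 = 0`, `f(s) → ±∞` as `s → ±∞`. -/
def A1 (f : ℝ → ℝ) : Prop :=
  Continuous f ∧ StrictMono f ∧ f 0 = 0 ∧ Tendsto f atTop atTop ∧ Tendsto f atBot atBot

/-- (A2) with exponent `α`: `g` is continuous, positive, and `|s|^α g(s)` has positive
limits as `s → ±∞`. -/
def A2 (g : ℝ → ℝ) (α : ℝ) : Prop :=
  Continuous g ∧ (∀ s, 0 < g s) ∧
  ∃ Cgp Cgm : ℝ, 0 < Cgp ∧ 0 < Cgm ∧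
    Tendsto (fun s => |s| ^ α * g s) atTop (𝓝 Cgp) ∧
    Tendsto (fun s => |s| ^ α * g s) atBot (𝓝 Cgm)

/-- (A3) with exponent `β > 0`: `|s|^(-β) f s → ±C_{f±}` as `s → ±∞`. -/
def A3 (f : ℝ → ℝ) (β : ℝ) : Prop :=
  0 < β ∧ ∃ Cfp Cfm : ℝ, 0 < Cfp ∧ 0 < Cfm ∧
    Tendsto (fun s => |s| ^ (-β) * f s) atTop (𝓝 Cfp) ∧
    Tendsto (fun s => |s| ^ (-β) * f s) atBot (𝓝 (-Cfm))

/-- (B1): `u₀ ∈ C([-b,b])`. -/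
def B1 (b : ℝ) (u0 : ℝ → ℝ) : Prop := ContinuousOn u0 (Icc (-b) b)

/-- (B2): `u₀ ∈ C((-b,b))`, diverging to `∞` at `±b` with polynomial rate bound. -/
def B2 (b : ℝ) (u0 : ℝ → ℝ) : Prop :=
  ContinuousOn u0 (Ioo (-b) b) ∧
  Tendsto u0 (𝓝[<] b) atTop ∧ Tendsto u0 (𝓝[>] (-b)) atTop ∧
  ∃ γ : ℝ, 0 < γ ∧
    (∃ C : ℝ, ∀ᶠ x in 𝓝[<] b, u0 x * (b - x) ^ γ ≤ C) ∧
    (∃ C : ℝ, ∀ᶠ x in 𝓝[>] (-b), u0 x * (b + x) ^ γ ≤ C)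

/-- `ψ_γ(s) = s^(-γ)` for `γ > 0` and `ψ₀(s) = -log s`. -/
def psi (γ : ℝ) (s : ℝ) : ℝ := if 0 < γ then s ^ (-γ) else -Real.log s

/-- (B3): `u₀ ∈ C((-b,b))` behaves like `D₊ ψ_{γ₊}(b-x)` near `b` and like
`D₋ ψ_{γ₋}(b+x)` near `-b`, up to constants. -/
def B3 (b : ℝ) (u0 : ℝ → ℝ) (γp γm Dp Dm : ℝ) : Prop :=
  ContinuousOn u0 (Ioo (-b) b) ∧ 0 ≤ γp ∧ 0 ≤ γm ∧ 0 < Dp ∧ 0 < Dm ∧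
  ∃ Cp Cm : ℝ,
    Tendsto (fun x => u0 x - Dp * psi γp (b - x)) (𝓝[<] b) (𝓝 Cp) ∧
    Tendsto (fun x => u0 x - Dm * psi γm (b + x)) (𝓝[>] (-b)) (𝓝 Cm)

/-- Viscosity sub-solution of `u_t - f(g(u_x) u_{xx}) = 0` in `Q`. -/
def IsSubSol (b : ℝ) (f g : ℝ → ℝ) (u : ℝ × ℝ → ℝ) : Prop :=
  UpperSemicontinuousOn u (Q0set b) ∧
  ∀ φ : ℝ × ℝ → ℝ, ContDiffOn ℝ 2 φ (Qset b) →
    ∀ p ∈ Qset b, IsLocalMaxOn (fun q => u q - φ q) (Qset b) p →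
      pT φ p - f (g (pX φ p) * pXX φ p) ≤ 0

/-- The singular Dirichlet boundary condition at time `t`:
`v(x,t) → ∞` as `x → ±b`. -/
def SingularBC (b : ℝ) (v : ℝ × ℝ → ℝ) (t : ℝ) : Prop :=
  Tendsto (fun x => v (x, t)) (𝓝[<] b) atTop ∧
  Tendsto (fun x => v (x, t)) (𝓝[>] (-b)) atTop

/-- Viscosity super-solution of `u_t - f(g(u_x) u_{xx}) = 0` in `Q` together with the
singular Dirichlet boundary condition. -/
def IsSuperSol (b : ℝ) (f g : ℝ → ℝ) (v : ℝ × ℝ → ℝ) : Prop :=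
  LowerSemicontinuousOn v (Q0set b) ∧
  (∀ φ : ℝ × ℝ → ℝ, ContDiffOn ℝ 2 φ (Qset b) →
    ∀ p ∈ Qset b, IsLocalMinOn (fun q => v q - φ q) (Qset b) p →
      0 ≤ pT φ p - f (g (pX φ p) * pXX φ p)) ∧
  (∀ t : ℝ, 0 < t → SingularBC b v t)

/-- Upper semicontinuous envelope relative to `Q₀`. -/
def uscEnv (b : ℝ) (u : ℝ × ℝ → ℝ) (p : ℝ × ℝ) : ℝ := limsup u (𝓝[Q0set b] p)

/-- Lower semicontinuous envelope relative to `Q₀`. -/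
def lscEnv (b : ℝ) (u : ℝ × ℝ → ℝ) (p : ℝ × ℝ) : ℝ := liminf u (𝓝[Q0set b] p)

/-- Viscosity solution of the initial value problem: `u*` is a sub-solution, `u_*` is a
super-solution (including the singular Dirichlet condition), and both envelopes agree
with `u₀` at `t = 0`. -/
def IsVSol (b : ℝ) (f g : ℝ → ℝ) (u0 : ℝ → ℝ) (u : ℝ × ℝ → ℝ) : Prop :=
  IsSubSol b f g (uscEnv b u) ∧ IsSuperSol b f g (lscEnv b u) ∧
  ∀ x ∈ Ioo (-b) b, uscEnv b u (x, 0) = u0 x ∧ lscEnv b u (x, 0) = u0 x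


lemma G_asym (G g : ℝ → ℝ) (α C : ℝ) (hα : α < 1) (hC : 0 < C)
    (dG : ∀ p, HasDerivAt G (g p) p)
    (hlim : Tendsto (fun s => |s| ^ α * g s) atTop (𝓝 C)) :
    ∃ c K : ℝ, 0 < c ∧ 0 < K ∧ ∀ p, 0 ≤ p →
      c * p ^ (1 - α) - K ≤ G p ∧ G p ≤ K * p ^ (1 - α) + K := by
  have hr : 0 < 1 - α := by linarith
  have h1 : ∀ᶠ s in atTop, C / 2 < |s| ^ α * g s ∧ |s| ^ α * g s < 2 * C :=
    (hlim.eventually (lt_mem_nhds (by linarith))).and (hlim.eventually (gt_mem_nhds (by linarith)))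
  obtain ⟨S, hS⟩ := eventually_atTop.1 h1
  set S0 := max S 1 with hS0
  have hS01 : 1 ≤ S0 := le_max_right _ _
  have hb : ∀ p, S0 ≤ p → C / 2 * p ^ (-α) ≤ g p ∧ g p ≤ 2 * C * p ^ (-α) := by
    intro p hp
    have hp0 : 0 < p := by linarith
    obtain ⟨ha, hb⟩ := hS p (le_trans (le_max_left _ _) hp)
    rw [abs_of_pos hp0] at ha hb
    have hpp : 0 < p ^ α := Real.rpow_pos_of_pos hp0 _
    rw [Real.rpow_neg hp0.le]
    constructor
    · rw [← div_eq_mul_inv, div_le_iff₀ hpp]; linarith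
    · rw [← div_eq_mul_inv, le_div_iff₀ hpp]; linarith
  have hdr : ∀ p, S0 ≤ p → ∀ a : ℝ, HasDerivAt (fun p => a / (1 - α) * p ^ (1 - α)) (a * p ^ (-α)) p := by
    intro p hp a
    have hp0 : 0 < p := by linarith
    have := (Real.hasDerivAt_rpow_const (p := 1 - α) (x := p) (Or.inl hp0.ne')).const_mul (a / (1 - α))
    have e : a / (1 - α) * ((1 - α) * p ^ (1 - α - 1)) = a * p ^ (-α) := by
      rw [show 1 - α - 1 = -α by ring]
      field_simp
    rwa [e] at this
  have hGc : Continuous G := continuous_iff_continuousAt.2 fun p => (dG p).continuousAt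
  have key1 : MonotoneOn (fun p => G p - C / 2 / (1 - α) * p ^ (1 - α)) (Ici S0) := by
    apply monotoneOn_of_hasDerivWithinAt_nonneg (convex_Ici _)
      (f' := fun p => g p - C / 2 * p ^ (-α))
    · intro p hp
      exact ((dG p).sub (hdr p hp (C / 2))).continuousAt.continuousWithinAt
    · intro p hp
      exact ((dG p).sub (hdr p (interior_subset hp) (C / 2))).hasDerivWithinAt
    · intro p hp
      have := (hb p (interior_subset hp)).1
      linarith
  have key2 : MonotoneOn (fun p => 2 * C / (1 - α) * p ^ (1 - α) - G p) (Ici S0) := by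
    apply monotoneOn_of_hasDerivWithinAt_nonneg (convex_Ici _)
      (f' := fun p => 2 * C * p ^ (-α) - g p)
    · intro p hp
      exact ((hdr p hp (2 * C)).sub (dG p)).continuousAt.continuousWithinAt
    · intro p hp
      exact ((hdr p (interior_subset hp) (2 * C)).sub (dG p)).hasDerivWithinAt
    · intro p hp
      have := (hb p (interior_subset hp)).2
      linarith
  obtain ⟨K0, hK0⟩ := (isCompact_Icc (a := (0:ℝ)) (b := S0)).exists_bound_of_continuousOn hGc.continuousOn
  have hK00 : 0 ≤ K0 := (norm_nonneg _).trans (hK0 0 ⟨le_rfl, by linarith⟩)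
  have hSr : 0 ≤ S0 ^ (1 - α) := Real.rpow_nonneg (by linarith) _
  refine ⟨C / 2 / (1 - α), K0 + C / 2 / (1 - α) * S0 ^ (1 - α) + 2 * C / (1 - α) , by positivity, by positivity, ?_⟩
  intro p hp
  have hpr : 0 ≤ p ^ (1 - α) := Real.rpow_nonneg hp _
  have e1 : 0 ≤ C / 2 / (1 - α) * S0 ^ (1 - α) := by positivity
  have e2 : 0 < 2 * C / (1 - α) := by positivity
  rcases le_total p S0 with h | h
  · have hk := abs_le.1 (hK0 p ⟨hp, h⟩)
    have : p ^ (1 - α) ≤ S0 ^ (1 - α) := Real.rpow_le_rpow hp h hr.le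
    have e3 : C / 2 / (1 - α) * p ^ (1 - α) ≤ C / 2 / (1 - α) * S0 ^ (1 - α) := by gcongr
    constructor
    · linarith
    · have : 0 ≤ (K0 + C / 2 / (1 - α) * S0 ^ (1 - α) + 2 * C / (1 - α)) * p ^ (1 - α) := by positivity
      linarith
  · have hk := abs_le.1 (hK0 S0 ⟨by linarith, le_rfl⟩)
    have k1 := key1 (mem_Ici.2 le_rfl) (mem_Ici.2 h) h
    have k2 := key2 (mem_Ici.2 le_rfl) (mem_Ici.2 h) h
    simp only at k1 k2
    constructor
    · linarith
    · have : 0 ≤ (K0 + C / 2 / (1 - α) * S0 ^ (1 - α)) * p ^ (1 - α) := by positivity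
      have : 0 ≤ 2 * C / (1 - α) * S0 ^ (1 - α) := by positivity
      nlinarith

/-- primitive `G` of `g` with inverse `P`, and power bounds on `G`. -/
structure GPdata (g G P : ℝ → ℝ) (r : ℝ) : Prop where
  r0 : 0 < r
  gpos : ∀ p, 0 < g p
  gc : Continuous g
  dG : ∀ p, HasDerivAt G (g p) p
  G0 : G 0 = 0
  GP : ∀ y, G (P y) = y
  PG : ∀ p, P (G p) = p
  Gm : StrictMono G
  Pm : StrictMono P
  Pc : Continuous P
  dP : ∀ y, HasDerivAt P (g (P y))⁻¹ y
  asym : ∃ c K : ℝ, 0 < c ∧ 0 < K ∧ ∀ p, 0 ≤ p →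
      (c * p ^ r - K ≤ G p ∧ G p ≤ K * p ^ r + K) ∧
      (c * p ^ r - K ≤ - G (-p) ∧ - G (-p) ≤ K * p ^ r + K)

lemma exists_GP (g : ℝ → ℝ) (α : ℝ) (hα : α < 1) (hgc : Continuous g) (hgp : ∀ s, 0 < g s)
    (Cp Cm : ℝ) (hCp : 0 < Cp) (hCm : 0 < Cm)
    (hp : Tendsto (fun s => |s| ^ α * g s) atTop (𝓝 Cp))
    (hm : Tendsto (fun s => |s| ^ α * g s) atBot (𝓝 Cm)) :
    ∃ G P, GPdata g G P (1 - α) := by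
  have hr : 0 < 1 - α := by linarith
  set G : ℝ → ℝ := fun p => ∫ s in (0:ℝ)..p, g s with hG
  have dG : ∀ p, HasDerivAt G (g p) p := fun p =>
    intervalIntegral.integral_hasDerivAt_right (hgc.intervalIntegrable _ _)
      (hgc.stronglyMeasurableAtFilter _ _) hgc.continuousAt
  have hGc : Continuous G := continuous_iff_continuousAt.2 fun p => (dG p).continuousAt
  have Gm : StrictMono G := strictMono_of_hasDerivAt_pos dG hgp
  obtain ⟨c1, K1, hc1, hK1, h1⟩ := G_asym G g α Cp hα hCp dG hp
  obtain ⟨c2, K2, hc2, hK2, h2⟩ := G_asym (fun p => - G (-p)) (fun p => g (-p)) α Cm hα hCm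
    (fun p => by
      have := ((dG (-p)).comp p (hasDerivAt_neg p)).neg
      have e : -(g (-p) * -1) = g (-p) := by ring
      rw [e] at this
      exact this)
    (by
      have := hm.comp tendsto_neg_atTop_atBot
      refine this.congr fun s => ?_
      simp)
  have asym : ∃ c K : ℝ, 0 < c ∧ 0 < K ∧ ∀ p, 0 ≤ p →
      (c * p ^ (1 - α) - K ≤ G p ∧ G p ≤ K * p ^ (1 - α) + K) ∧
      (c * p ^ (1 - α) - K ≤ - G (-p) ∧ - G (-p) ≤ K * p ^ (1 - α) + K) := by
    refine ⟨min c1 c2, max K1 K2, lt_min hc1 hc2, lt_max_of_lt_left hK1, fun p hp => ?_⟩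
    have hpr : 0 ≤ p ^ (1 - α) := Real.rpow_nonneg hp _
    have a1 := mul_le_mul_of_nonneg_right (min_le_left c1 c2) hpr
    have a2 := mul_le_mul_of_nonneg_right (min_le_right c1 c2) hpr
    have a3 := mul_le_mul_of_nonneg_right (le_max_left K1 K2) hpr
    have a4 := mul_le_mul_of_nonneg_right (le_max_right K1 K2) hpr
    have a5 := le_max_left K1 K2
    have a6 := le_max_right K1 K2
    have := h1 p hp
    have := h2 p hp
    refine ⟨⟨?_, ?_⟩, ?_, ?_⟩ <;> linarith
  have hsurj : Function.Surjective G := by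
    obtain ⟨c, K, hc, hK, h⟩ := asym
    have hpow : Tendsto (fun p : ℝ => c * p ^ (1 - α) - K) atTop atTop :=
      tendsto_atTop_add_const_right _ _ ((tendsto_rpow_atTop hr).const_mul_atTop hc)
    apply hGc.surjective
    · apply tendsto_atTop_mono' _ _ hpow
      filter_upwards [eventually_ge_atTop 0] with p hp using (h p hp).1.1
    · have : Tendsto (fun p => - G (-p)) atTop atTop := by
        apply tendsto_atTop_mono' _ _ hpow
        filter_upwards [eventually_ge_atTop 0] with p hp using (h p hp).2.1
      have := (tendsto_neg_atTop_atBot.comp this).comp tendsto_neg_atBot_atTop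
      refine this.congr fun s => ?_
      simp
  set e := Gm.orderIsoOfSurjective G hsurj with he
  have heG : ∀ p, e p = G p := fun p => rfl
  have GP : ∀ y, G (e.symm y) = y := fun y => by rw [← heG]; exact e.apply_symm_apply y
  refine ⟨G, e.symm, hr, hgp, hgc, dG, by simp [hG], GP,
    fun p => by rw [← heG]; exact e.symm_apply_apply p, Gm, e.symm.strictMono, e.symm.continuous, ?_, asym⟩
  intro y
  exact HasDerivAt.of_local_left_inverse e.symm.continuous.continuousAt (dG _) (hgp _).ne'
    (Eventually.of_forall GP)

def Phi (G P : ℝ → ℝ) (κ k z : ℝ) : ℝ := ∫ y in (0:ℝ)..z, P (G k + κ * y)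

/-- profile of a travelling wave. -/
def IsWave (g : ℝ → ℝ) (κ : ℝ) (A : ℝ → ℝ) : Prop :=
  ContDiff ℝ 2 A ∧ ∀ x, g (deriv A x) * deriv (deriv A) x = κ

section waves
variable {g G P : ℝ → ℝ} {r : ℝ}

lemma Phi_zero (κ k : ℝ) : Phi G P κ k 0 = 0 := by simp [Phi]

lemma Phi_deriv (h : GPdata g G P r) (κ k z : ℝ) :
    HasDerivAt (Phi G P κ k) (P (G k + κ * z)) z := by
  have hc : Continuous fun y => P (G k + κ * y) := h.Pc.comp (by fun_prop)
  exact intervalIntegral.integral_hasDerivAt_right (hc.intervalIntegrable _ _)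
      (hc.stronglyMeasurableAtFilter _ _) hc.continuousAt

lemma Phi_cont (h : GPdata g G P r) (κ k : ℝ) : Continuous (Phi G P κ k) :=
  continuous_iff_continuousAt.2 fun z => (Phi_deriv h κ k z).continuousAt

lemma wave_Phi (h : GPdata g G P r) (κ k C0 x0 : ℝ) :
    IsWave g κ (fun x => C0 + Phi G P κ k (x - x0)) := by
  have d1 : ∀ x, HasDerivAt (fun x => C0 + Phi G P κ k (x - x0)) (P (G k + κ * (x - x0))) x := by
    intro x
    have := ((Phi_deriv h κ k (x - x0)).comp x ((hasDerivAt_id x).sub_const x0)).const_add C0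
    rw [mul_one] at this
    exact this
  have e1 : deriv (fun x => C0 + Phi G P κ k (x - x0)) = fun x => P (G k + κ * (x - x0)) :=
    funext fun x => (d1 x).deriv
  have d2 : ∀ x, HasDerivAt (fun x => P (G k + κ * (x - x0)))
      ((g (P (G k + κ * (x - x0))))⁻¹ * κ) x := by
    intro x
    have h0 : HasDerivAt (fun x => G k + κ * (x - x0)) (κ * 1) x :=
      (((hasDerivAt_id x).sub_const x0).const_mul κ).const_add (G k)
    rw [mul_one] at h0
    exact (h.dP (G k + κ * (x - x0))).comp x h0
  have e2 : deriv (fun x => P (G k + κ * (x - x0))) = fun x => (g (P (G k + κ * (x - x0))))⁻¹ * κ :=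
    funext fun x => (d2 x).deriv
  constructor
  · rw [show (2 : WithTop ℕ∞) = 1 + 1 by norm_num, contDiff_succ_iff_deriv]
    refine ⟨fun x => (d1 x).differentiableAt, by simp, ?_⟩
    rw [e1, contDiff_one_iff_deriv]
    refine ⟨fun x => (d2 x).differentiableAt, ?_⟩
    rw [e2]
    have hc : Continuous fun x => g (P (G k + κ * (x - x0))) :=
      h.gc.comp (h.Pc.comp (by fun_prop))
    exact (hc.inv₀ fun x => (h.gpos _).ne').mul continuous_const
  · intro x
    rw [e1, e2]
    have := (h.gpos (P (G k + κ * (x - x0)))).ne'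
    field_simp

lemma wave_affine (g : ℝ → ℝ) (C0 k : ℝ) : IsWave g 0 (fun x => C0 + k * x) := by
  have e1 : deriv (fun x => C0 + k * x) = fun _ => k := by
    funext x
    have := ((hasDerivAt_id x).const_mul k).const_add C0
    rw [mul_one] at this
    exact this.deriv
  constructor
  · fun_prop
  · intro x
    rw [e1]; simp

lemma Phi_slope (h : GPdata g G P r) (κ k : ℝ) {z1 z2 : ℝ} (hz : z1 < z2) :
    ∃ c ∈ Ioo z1 z2, Phi G P κ k z2 - Phi G P κ k z1 = P (G k + κ * c) * (z2 - z1) := by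
  obtain ⟨c, hc, h1⟩ := exists_hasDerivAt_eq_slope (Phi G P κ k) (fun z => P (G k + κ * z)) hz
    (Phi_cont h κ k).continuousOn (fun z _ => Phi_deriv h κ k z)
  refine ⟨c, hc, ?_⟩
  rw [h1, div_mul_cancel₀]
  linarith

lemma Phi_bd_pos (h : GPdata g G P r) {κ k : ℝ} (hκ : 0 ≤ κ) {z1 z2 : ℝ} (hz : z1 ≤ z2) :
    P (G k + κ * z1) * (z2 - z1) ≤ Phi G P κ k z2 - Phi G P κ k z1 ∧
    Phi G P κ k z2 - Phi G P κ k z1 ≤ P (G k + κ * z2) * (z2 - z1) := by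
  rcases hz.eq_or_lt with rfl | hz
  · simp
  obtain ⟨c, hc, e⟩ := Phi_slope h κ k hz
  rw [e]
  have h0 : 0 ≤ z2 - z1 := by linarith
  constructor
  · apply mul_le_mul_of_nonneg_right _ h0
    apply h.Pm.monotone
    nlinarith [hc.1]
  · apply mul_le_mul_of_nonneg_right _ h0
    apply h.Pm.monotone
    nlinarith [hc.2]

lemma Phi_bd_neg (h : GPdata g G P r) {κ k : ℝ} (hκ : κ ≤ 0) {z1 z2 : ℝ} (hz : z1 ≤ z2) :
    P (G k + κ * z2) * (z2 - z1) ≤ Phi G P κ k z2 - Phi G P κ k z1 ∧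
    Phi G P κ k z2 - Phi G P κ k z1 ≤ P (G k + κ * z1) * (z2 - z1) := by
  rcases hz.eq_or_lt with rfl | hz
  · simp
  obtain ⟨c, hc, e⟩ := Phi_slope h κ k hz
  rw [e]
  have h0 : 0 ≤ z2 - z1 := by linarith
  constructor
  · apply mul_le_mul_of_nonneg_right _ h0
    apply h.Pm.monotone
    nlinarith [hc.2]
  · apply mul_le_mul_of_nonneg_right _ h0
    apply h.Pm.monotone
    nlinarith [hc.1]

/-- concave waves lie below their tangent. -/
lemma Phi_le_tangent (h : GPdata g G P r) {κ k : ℝ} (hκ : κ ≤ 0) (z : ℝ) :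
    Phi G P κ k z ≤ k * z := by
  have e : P (G k + κ * 0) = k := by rw [mul_zero, add_zero, h.PG]
  have e0 : Phi G P κ k 0 = 0 := Phi_zero _ _
  rcases le_total 0 z with hz | hz
  · have := (Phi_bd_neg h hκ (k := k) hz).2
    rw [e, e0] at this
    linarith
  · have := (Phi_bd_neg h hκ (k := k) hz).1
    rw [e, e0] at this
    linarith

/-- convex waves lie above their tangent. -/
lemma Phi_ge_tangent (h : GPdata g G P r) {κ k : ℝ} (hκ : 0 ≤ κ) (z : ℝ) :
    k * z ≤ Phi G P κ k z := by
  have e : P (G k + κ * 0) = k := by rw [mul_zero, add_zero, h.PG]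
  have e0 : Phi G P κ k 0 = 0 := Phi_zero _ _
  rcases le_total 0 z with hz | hz
  · have := (Phi_bd_pos h hκ (k := k) hz).1
    rw [e, e0] at this
    linarith
  · have := (Phi_bd_pos h hκ (k := k) hz).2
    rw [e, e0] at this
    linarith

/-- concavity on `[0,L]`. -/
lemma Phi_chord (h : GPdata g G P r) {κ k : ℝ} (hκ : κ ≤ 0) {y L : ℝ} (hy : 0 ≤ y) (hyL : y ≤ L) :
    y * Phi G P κ k L ≤ L * Phi G P κ k y := by
  have h1 := (Phi_bd_neg h hκ (k := k) hy).1
  have h2 := (Phi_bd_neg h hκ (k := k) hyL).2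
  rw [Phi_zero] at h1
  have h3 : 0 ≤ L - y := by linarith
  nlinarith [mul_le_mul_of_nonneg_left h1 h3, mul_le_mul_of_nonneg_left h2 hy]

/-- comparison of the growth of `P` on both sides. -/
lemma P_cmp (h : GPdata g G P r) (k : ℝ) (δ : ℝ) (hδ : 0 < δ) :
    ∃ ε C : ℝ, 0 < ε ∧ 0 < C ∧ ∀ Y, 0 ≤ Y →
      P (G k + ε * Y) - k ≤ δ * (k - P (G k - Y)) + C := by
  obtain ⟨c, K, hc, hK, hA⟩ := h.asym
  have hr := h.r0
  -- choose `ε`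
  set e1 : ℝ := δ ^ r / 2 with he1
  have he1p : 0 < e1 := by positivity
  set ε : ℝ := c * e1 / K with hε
  have hεp : 0 < ε := by positivity
  set C9 : ℝ := (|G k| + K + ε * (|G k| + K)) / c with hC9
  have hC9p : 0 < C9 := by positivity
  refine ⟨ε, (2 * C9) ^ (1 / r) + |k| + δ * |k| + (ε*0 + 1) + |P (G k + ε * (|G k| + G 0))|, hεp, by positivity, ?_⟩
  intro Y hY
  have hq : 0 ≤ (2 * C9) ^ (1 / r) := by positivity
  have hk1 := neg_abs_le k
  have hk2 := le_abs_self k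
  have hΔ : 0 ≤ k - P (G k - Y) := by
    have : P (G k - Y) ≤ P (G k) := h.Pm.monotone (by linarith)
    rw [h.PG] at this; linarith
  have hδΔ := mul_nonneg hδ.le hΔ
  have hab := abs_nonneg (P (G k + ε * (|G k| + G 0)))
  have hδk := mul_nonneg hδ.le (abs_nonneg k)
  rcases le_or_gt (P (G k + ε * Y)) 0 with hp1 | hp1
  · nlinarith
  rcases le_or_gt 0 (P (G k - Y)) with hp2 | hp2
  · -- then `Y ≤ G k`
    have : Y ≤ |G k| + G 0 := by
      have := h.Gm.monotone hp2
      rw [h.GP] at this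
      have := le_abs_self (G k)
      rw [h.G0] at *
      linarith
    have h3 : P (G k + ε * Y) ≤ P (G k + ε * (|G k| + G 0)) := h.Pm.monotone (by gcongr)
    have := le_abs_self (P (G k + ε * (|G k| + G 0)))
    linarith
  set p1 := P (G k + ε * Y) with hp1d
  set p2 := - P (G k - Y) with hp2d
  have hp2p : 0 < p2 := by linarith
  have i1 := (hA p1 hp1.le).1.1
  have i2 := (hA p2 hp2p.le).2.2
  rw [hp1d, h.GP, ← hp1d] at i1
  rw [hp2d, neg_neg, h.GP, ← hp2d] at i2
  have hgk := le_abs_self (G k)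
  have hgk' := neg_abs_le (G k)
  have i3 : p1 ^ r ≤ C9 + e1 * p2 ^ r := by
    have : c * p1 ^ r ≤ c * (C9 + e1 * p2 ^ r) := by
      have hcC : c * C9 = |G k| + K + ε * (|G k| + K) := by rw [hC9]; field_simp
      have hce : c * e1 = ε * K := by rw [hε]; field_simp
      have hY' : Y ≤ K * p2 ^ r + (K + |G k|) := by linarith
      have := mul_le_mul_of_nonneg_left hY' hεp.le
      calc c * p1 ^ r ≤ G k + ε * Y + K := by linarith
        _ ≤ |G k| + K + ε * (|G k| + K) + ε * K * p2 ^ r := by nlinarith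
        _ = c * (C9 + e1 * p2 ^ r) := by rw [mul_add c C9, hcC, ← mul_assoc c, hce]
    exact le_of_mul_le_mul_left this hc
  have hrr : ∀ a : ℝ, 0 ≤ a → (a ^ r) ^ (1 / r) = a := fun a ha => by
    rw [← Real.rpow_mul ha]; field_simp; simp
  have i4 : p1 ≤ δ * p2 + (2 * C9) ^ (1 / r) := by
    rcases le_total C9 (e1 * p2 ^ r) with hh | hh
    · have : p1 ^ r ≤ (δ * p2) ^ r := by
        rw [Real.mul_rpow hδ.le hp2p.le]
        have : e1 * p2 ^ r + e1 * p2 ^ r = δ ^ r * p2 ^ r := by rw [he1]; ring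
        linarith
      have := (Real.rpow_le_rpow_iff hp1.le (by positivity) hr).1 this
      linarith
    · have : p1 ^ r ≤ 2 * C9 := by linarith
      have := Real.rpow_le_rpow (by positivity) this (by positivity : 0 ≤ 1 / r)
      rw [hrr p1 hp1.le] at this
      have : 0 ≤ δ * p2 := by positivity
      linarith
  have : δ * (k - P (G k - Y)) = δ * k + δ * p2 := by rw [hp2d]; ring
  have : -(δ * |k|) ≤ δ * k := by nlinarith
  linarith
end waves

/-- the properties of a super-solution which are used in the proof. -/
structure SP (b : ℝ) (f g : ℝ → ℝ) (v : ℝ × ℝ → ℝ) : Prop where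
  lsc : LowerSemicontinuousOn v (Ioo (-b) b ×ˢ Ioi (0:ℝ))
  test : ∀ A h : ℝ → ℝ, ContDiff ℝ 2 A → ContDiff ℝ 2 h → ∀ x t : ℝ, x ∈ Ioo (-b) b → 0 < t →
    IsLocalMin (fun q : ℝ × ℝ => v q - (A q.1 + h q.2)) (x, t) →
    f (g (deriv A x) * deriv (deriv A) x) ≤ deriv h t
  bcR : ∀ t, 0 < t → Tendsto (fun x => v (x, t)) (𝓝[<] b) atTop
  bcL : ∀ t, 0 < t → Tendsto (fun x => v (x, t)) (𝓝[>] (-b)) atTop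

lemma SP.reflect {b : ℝ} {f g : ℝ → ℝ} {v : ℝ × ℝ → ℝ} (S : SP b f g v) :
    SP b f (fun p => g (-p)) (fun q => v (-q.1, q.2)) := by
  refine ⟨?_, ?_, ?_, ?_⟩
  · have hc : Continuous fun q : ℝ × ℝ => ((-q.1, q.2) : ℝ × ℝ) := by fun_prop
    intro q hq y hy
    have hm : ((-q.1, q.2) : ℝ × ℝ) ∈ Ioo (-b) b ×ˢ Ioi (0:ℝ) := by
      refine ⟨⟨?_, ?_⟩, hq.2⟩
      · have := hq.1.2; simp; linarith
      · have := hq.1.1; simp; linarith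
    have := S.lsc _ hm y hy
    have ht : Tendsto (fun q : ℝ × ℝ => ((-q.1, q.2) : ℝ × ℝ)) (𝓝[Ioo (-b) b ×ˢ Ioi (0:ℝ)] q)
        (𝓝[Ioo (-b) b ×ˢ Ioi (0:ℝ)] ((-q.1, q.2) : ℝ × ℝ)) := by
      apply tendsto_nhdsWithin_of_tendsto_nhds_of_eventually_within
      · exact (hc.tendsto q).mono_left nhdsWithin_le_nhds
      · filter_upwards [self_mem_nhdsWithin] with p hp
        refine ⟨⟨?_, ?_⟩, hp.2⟩
        · have := hp.1.2; simp; linarith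
        · have := hp.1.1; simp; linarith
    exact ht.eventually this
  · intro A h hA hh x t hx ht hm
    have hA' : ContDiff ℝ 2 (fun y => A (-y)) := hA.comp contDiff_neg
    have e1 : deriv (fun y => A (-y)) = fun y => - deriv A (-y) := by
      funext y; exact deriv_comp_neg A y
    have e2 : deriv (deriv (fun y => A (-y))) (-x) = deriv (deriv A) x := by
      rw [e1]
      have : (fun y => - deriv A (-y)) = fun y => -((fun z => deriv A (-z)) y) := rfl
      rw [this, deriv.fun_neg, deriv_comp_neg]
      simp
    have e1' : deriv (fun y => A (-y)) (-x) = - deriv A x := by rw [e1]; simp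
    have key := S.test (fun y => A (-y)) h hA' hh (-x) t
      ⟨by linarith [hx.2], by linarith [hx.1]⟩ ht ?_
    · rw [e2, e1'] at key
      exact key
    · have hc : Continuous fun q : ℝ × ℝ => ((-q.1, q.2) : ℝ × ℝ) := by fun_prop
      have htd : Tendsto (fun q : ℝ × ℝ => ((-q.1, q.2) : ℝ × ℝ)) (𝓝 (-x, t)) (𝓝 (x, t)) := by
        have := hc.tendsto (-x, t)
        simpa using this
      have := htd.eventually hm
      filter_upwards [this] with q hq
      simpa using hq
  · intro t ht
    refine (S.bcL t ht).comp ?_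
    apply tendsto_nhdsWithin_of_tendsto_nhds_of_eventually_within
    · exact (continuous_neg.tendsto b).mono_left nhdsWithin_le_nhds
    · filter_upwards [self_mem_nhdsWithin] with p hp
      have : p < b := hp
      simpa using this
  · intro t ht
    refine (S.bcR t ht).comp ?_
    apply tendsto_nhdsWithin_of_tendsto_nhds_of_eventually_within
    · have := continuous_neg.tendsto (-b)
      rw [neg_neg] at this
      exact this.mono_left nhdsWithin_le_nhds
    · filter_upwards [self_mem_nhdsWithin] with p hp
      have : -b < p := hp
      show -p < b
      linarith

lemma comparison {b : ℝ} {f g : ℝ → ℝ} {v : ℝ × ℝ → ℝ} (S : SP b f g v)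
    {κ c : ℝ} {A : ℝ → ℝ} (hA : IsWave g κ A) (hc : c ≤ f κ) {x1 x2 s t : ℝ}
    (h1 : -b < x1) (h2 : x2 < b) (hs : 0 < s)
    (hL : ∀ τ ∈ Ico s t, A x1 + c * (τ - s) ≤ v (x1, τ))
    (hR : ∀ τ ∈ Ico s t, A x2 + c * (τ - s) ≤ v (x2, τ))
    (h0 : ∀ x ∈ Icc x1 x2, A x ≤ v (x, s)) :
    ∀ τ ∈ Ico s t, ∀ x ∈ Icc x1 x2, A x + c * (τ - s) ≤ v (x, τ) := by
  intro t0 ht0 x0 hx0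
  by_contra hcon
  push Not at hcon
  have hAc : Continuous A := hA.1.continuous
  set K : Set (ℝ × ℝ) := Icc x1 x2 ×ˢ Icc s t with hK
  have hKc : IsCompact K := isCompact_Icc.prod isCompact_Icc
  have hKQ : K ⊆ Ioo (-b) b ×ˢ Ioi (0:ℝ) := by
    rintro ⟨x, τ⟩ ⟨hx, hτ⟩
    exact ⟨⟨lt_of_lt_of_le h1 hx.1, lt_of_le_of_lt hx.2 h2⟩, lt_of_lt_of_le hs hτ.1⟩
  have hlscW : ∀ E : ℝ × ℝ → ℝ, Continuous E → LowerSemicontinuousOn (fun q => v q + E q) K :=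
    fun E hE => (S.lsc.mono hKQ).add hE.continuousOn.lowerSemicontinuousOn
  have hE1 : Continuous fun q : ℝ × ℝ => -(A q.1 + c * (q.2 - s)) := by fun_prop
  obtain ⟨m, hm⟩ := (hlscW _ hE1).bddBelow_of_isCompact hKc
  have hm' : ∀ q ∈ K, m ≤ v q + -(A q.1 + c * (q.2 - s)) := fun q hq => hm ⟨q, hq, rfl⟩
  set η : ℝ := (A x0 + c * (t0 - s) - v (x0, t0)) / 2 with hη
  have hη0 : 0 < η := by rw [hη]; linarith
  have htt : 0 < t - t0 := by linarith [ht0.2]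
  set l : ℝ := (|m| + 1) / (η * (t - t0)) with hl
  have hl0 : 0 < l := by positivity
  set h : ℝ → ℝ := fun τ => c * (τ - s) - η * Real.exp (l * (τ - t0)) with hh
  have hhC : ContDiff ℝ 2 h := by
    rw [hh]; fun_prop
  have hE2 : Continuous fun q : ℝ × ℝ => -(A q.1 + h q.2) := by
    have := hhC.continuous
    fun_prop
  have hx0K : (x0, t0) ∈ K := ⟨hx0, ht0.1, ht0.2.le⟩
  obtain ⟨⟨xm, tm⟩, hq, hmin⟩ := (hlscW _ hE2).exists_isMinOn ⟨_, hx0K⟩ hKc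
  have hneg : v (xm, tm) + -(A xm + h tm) < 0 := by
    have : v (xm, tm) + -(A xm + h tm) ≤ v (x0, t0) + -(A x0 + h t0) := hmin hx0K
    have e : h t0 = c * (t0 - s) - η := by simp [hh]
    rw [e] at this
    linarith
  have hexp : ∀ τ, 0 < Real.exp (l * (τ - t0)) := fun τ => Real.exp_pos _
  have hneg' : v (xm, tm) < A xm + c * (tm - s) := by
    have : h tm = c * (tm - s) - η * Real.exp (l * (tm - t0)) := rfl
    nlinarith [hexp tm]
  obtain ⟨⟨hq1, hq2⟩, hq3, hq4⟩ := hq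
  simp only at hq1 hq2 hq3 hq4
  have htm : tm < t := by
    rcases hq4.lt_or_eq with h' | h'
    · exact h'
    exfalso
    have hm1 := hm' (xm, tm) ⟨⟨hq1, hq2⟩, hq3, hq4⟩
    have e : h tm = c * (tm - s) - η * Real.exp (l * (tm - t0)) := rfl
    have h3 : l * (tm - t0) + 1 ≤ Real.exp (l * (tm - t0)) := Real.add_one_le_exp _
    have h4 : η * (l * (tm - t0)) = |m| + 1 := by
      rw [h', hl]; field_simp
    have h5 := mul_le_mul_of_nonneg_left h3 hη0.le
    simp only at hm1
    have := neg_abs_le m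
    nlinarith
  have htm2 : s < tm := by
    rcases hq3.lt_or_eq with h' | h'
    · exact h'
    exfalso
    have := h0 xm ⟨hq1, hq2⟩
    rw [← h'] at hneg'
    simp at hneg'
    linarith
  have hxm1 : x1 < xm := by
    rcases hq1.lt_or_eq with h' | h'
    · exact h'
    exfalso
    have := hL tm ⟨hq3, htm⟩
    rw [h'] at this
    linarith
  have hxm2 : xm < x2 := by
    rcases hq2.lt_or_eq with h' | h'
    · exact h'
    exfalso
    have := hR tm ⟨hq3, htm⟩
    rw [← h'] at this
    linarith
  have hnh : K ∈ 𝓝 (xm, tm) := prod_mem_nhds (Icc_mem_nhds hxm1 hxm2) (Icc_mem_nhds htm2 htm)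
  have hloc : IsLocalMin (fun q : ℝ × ℝ => v q - (A q.1 + h q.2)) (xm, tm) := by
    have := hmin.isLocalMin hnh
    exact this
  have key := S.test A h hA.1 hhC xm tm ⟨by linarith, by linarith⟩ (by linarith) hloc
  rw [hA.2] at key
  have hd : HasDerivAt h (c * 1 - η * (Real.exp (l * (tm - t0)) * (l * 1))) tm := by
    have a1 := ((hasDerivAt_id tm).sub_const s).const_mul c
    have a2 := ((((hasDerivAt_id tm).sub_const t0).const_mul l).exp).const_mul η
    exact a1.sub a2
  rw [hd.deriv] at key
  have := mul_pos hη0 (mul_pos (hexp tm) hl0)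
  linarith

/-- comparison on the whole interval, given uniform lateral control near the ends. -/
lemma comparison_full {b : ℝ} {f g : ℝ → ℝ} {v : ℝ × ℝ → ℝ} (S : SP b f g v)
    {κ c : ℝ} {A : ℝ → ℝ} (hA : IsWave g κ A) (hc : c ≤ f κ) {s t : ℝ}
    (hs : 0 < s)
    (hL : ∃ a, -b < a ∧ ∀ x ∈ Ioc (-b) a, ∀ τ ∈ Ico s t, A x + c * (τ - s) ≤ v (x, τ))
    (hR : ∃ a, a < b ∧ ∀ x ∈ Ico a b, ∀ τ ∈ Ico s t, A x + c * (τ - s) ≤ v (x, τ))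
    (h0 : ∀ x ∈ Ioo (-b) b, A x ≤ v (x, s)) :
    ∀ τ ∈ Ico s t, ∀ x ∈ Ioo (-b) b, A x + c * (τ - s) ≤ v (x, τ) := by
  intro τ hτ x hx
  obtain ⟨a1, ha1, hL⟩ := hL
  obtain ⟨a2, ha2, hR⟩ := hR
  have m1 : -b < min a1 x := lt_min ha1 hx.1
  have m2 : max a2 x < b := max_lt ha2 hx.2
  refine comparison S hA hc (x1 := min a1 x) (x2 := max a2 x) m1 m2 hs
    (fun τ hτ => hL _ ⟨m1, min_le_left _ _⟩ τ hτ)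
    (fun τ hτ => hR _ ⟨le_max_left _ _, m2⟩ τ hτ)
    (fun y hy => h0 y ⟨lt_of_lt_of_le m1 hy.1, lt_of_le_of_lt hy.2 m2⟩) τ hτ x
    ⟨min_le_right _ _, le_max_right _ _⟩

/-- closedness from the left for affine functions. -/
lemma closed_left {b : ℝ} {f g : ℝ → ℝ} {v : ℝ × ℝ → ℝ} (S : SP b f g v) (hf0 : f 0 = 0)
    (C0 k t : ℝ) (ht : 0 < t)
    (hfr : ∃ᶠ τ in 𝓝[<] t, ∀ x ∈ Ioo (-b) b, C0 + k * x ≤ v (x, τ)) :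
    ∀ x ∈ Ioo (-b) b, C0 + k * x ≤ v (x, t) := by
  intro x hx
  have hcont : Continuous fun y : ℝ => C0 + k * y := by fun_prop
  have hl : ∃ x1 ∈ Ioo (-b) x, C0 + k * x1 < v (x1, t) := by
    have h1 : ∀ᶠ y in 𝓝[>] (-b), C0 + k * y < C0 + k * (-b) + 1 :=
      ((hcont.tendsto (-b)).mono_left nhdsWithin_le_nhds).eventually (gt_mem_nhds (by linarith))
    have h2 := (S.bcL t ht).eventually_ge_atTop (C0 + k * (-b) + 1)
    have h3 : ∀ᶠ y in 𝓝[>] (-b), y ∈ Ioo (-b) x := Ioo_mem_nhdsGT hx.1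
    obtain ⟨y, hy1, hy2, hy3⟩ := (h1.and (h2.and h3)).exists
    exact ⟨y, hy3, lt_of_lt_of_le hy1 hy2⟩
  have hr : ∃ x2 ∈ Ioo x b, C0 + k * x2 < v (x2, t) := by
    have h1 : ∀ᶠ y in 𝓝[<] b, C0 + k * y < C0 + k * b + 1 :=
      ((hcont.tendsto b).mono_left nhdsWithin_le_nhds).eventually (gt_mem_nhds (by linarith))
    have h2 := (S.bcR t ht).eventually_ge_atTop (C0 + k * b + 1)
    have h3 : ∀ᶠ y in 𝓝[<] b, y ∈ Ioo x b := Ioo_mem_nhdsLT hx.2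
    obtain ⟨y, hy1, hy2, hy3⟩ := (h1.and (h2.and h3)).exists
    exact ⟨y, hy3, lt_of_lt_of_le hy1 hy2⟩
  obtain ⟨x1, hx1, hv1⟩ := hl
  obtain ⟨x2, hx2, hv2⟩ := hr
  have hnb : ∀ y ∈ Ioo (-b) b, C0 + k * y < v (y, t) →
      ∀ᶠ τ in 𝓝 t, C0 + k * y < v (y, τ) := by
    intro y hy hv
    have hQ : Ioo (-b) b ×ˢ Ioi (0:ℝ) ∈ 𝓝 (y, t) :=
      prod_mem_nhds (Ioo_mem_nhds hy.1 hy.2) (Ioi_mem_nhds ht)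
    have := S.lsc (y, t) ⟨hy, ht⟩ _ hv
    rw [nhdsWithin_eq_nhds.2 hQ] at this
    have hc : Continuous fun τ : ℝ => ((y, τ) : ℝ × ℝ) := by fun_prop
    exact (hc.tendsto t).eventually this
  have hn := (hnb x1 ⟨hx1.1, hx1.2.trans hx.2⟩ hv1).and (hnb x2 ⟨hx.1.trans hx2.1, hx2.2⟩ hv2)
  obtain ⟨δ, hδ, hball⟩ := Metric.eventually_nhds_iff.1 hn
  have hI : ∀ᶠ τ in 𝓝[<] t, τ ∈ Ioo (max 0 (t - δ)) t :=
    Ioo_mem_nhdsLT (max_lt ht (by linarith))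
  obtain ⟨s, hs1, hs2⟩ := (hfr.and_eventually hI).exists
  have hs0 : 0 < s := lt_of_le_of_lt (le_max_left _ _) hs2.1
  have hsδ : t - δ < s := lt_of_le_of_lt (le_max_right _ _) hs2.1
  have hb' : ∀ τ ∈ Ico s (t + δ), dist τ t < δ := by
    intro τ hτ
    rw [Real.dist_eq, abs_lt]
    constructor <;> linarith [hτ.1, hτ.2]
  have := comparison S (wave_affine g C0 k) (c := 0) (by rw [hf0]) (x1 := x1) (x2 := x2) (s := s)
    (t := t + δ) hx1.1 hx2.2 hs0
    (fun τ hτ => by have := (hball (hb' τ hτ)).1; linarith)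
    (fun τ hτ => by have := (hball (hb' τ hτ)).2; linarith)
    (fun y hy => hs1 y ⟨lt_of_lt_of_le hx1.1 hy.1, lt_of_le_of_lt hy.2 hx2.2⟩)
    t ⟨hs2.2.le, by linarith⟩ x ⟨hx1.2.le, hx2.1.le⟩
  linarith

lemma baire_prop (t1 t2 : ℝ) (D : ℕ → Set ℝ) (mono : Monotone D)
    (cov : ∀ t ∈ Ioo t1 t2, ∃ j, t ∈ D j)
    (P1 : ∀ j, ∀ t ∈ Ioo t1 t2, (∃ᶠ τ in 𝓝[<] t, τ ∈ D j) → t ∈ D j)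
    (P2 : ∀ j s t, t1 < s → s < t → t < t2 → s ∈ D j →
      (∀ s1 t', s < s1 → s1 ≤ t' → t' < t → ∃ j', Icc s1 t' ⊆ D j') → ∀ τ ∈ Ioo s t, τ ∈ D j) :
    ∀ j s t, t1 < s → s ≤ t → t < t2 → s ∈ D j → t ∈ D j := by
  set O : Set ℝ := ⋃ j, interior (D j) with hO
  have hOo : IsOpen O := isOpen_iUnion fun j => isOpen_interior
  -- propagation across open gaps
  have P3 : ∀ j s t, t1 < s → s < t → t < t2 → s ∈ D j → Ioo s t ⊆ O → Icc s t ⊆ D j := by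
    intro j s t hs hst ht hsD hsub
    have h1 : ∀ τ ∈ Ioo s t, τ ∈ D j := by
      refine P2 j s t hs hst ht hsD ?_
      intro s1 t' h1 h2 h3
      have hc : Icc s1 t' ⊆ ⋃ j, interior (D j) := by
        intro y hy
        exact hsub ⟨lt_of_lt_of_le h1 hy.1, lt_of_le_of_lt hy.2 h3⟩
      obtain ⟨j', hj'⟩ := isCompact_Icc.elim_directed_cover _ (fun j => isOpen_interior) hc
        (directed_of_isDirected_le fun i j hij => interior_mono (mono hij))
      exact ⟨j', hj'.trans interior_subset⟩
    have h2 : t ∈ D j := by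
      apply P1 j t ⟨hs.trans hst, ht⟩
      apply Eventually.frequently
      filter_upwards [Ioo_mem_nhdsLT hst] with y hy using h1 y hy
    intro y hy
    rcases hy.1.eq_or_lt with rfl | hy1
    · exact hsD
    rcases hy.2.eq_or_lt with rfl | hy2
    · exact h2
    exact h1 y ⟨hy1, hy2⟩
  set B : Set ℝ := Ioo t1 t2 \ O with hB
  have hBmem : ∀ y ∈ Ioo t1 t2, y ∉ B → y ∈ O := by
    intro y hy hyB
    by_contra h
    exact hyB ⟨hy, h⟩
  have hBempty : ¬ B.Nonempty := by
    intro hBne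
    have hlc : IsLocallyClosed B := isOpen_Ioo.isLocallyClosed.inter hOo.isClosed_compl.isLocallyClosed
    haveI : LocallyCompactSpace B := hlc.locallyCompactSpace
    haveI : Nonempty B := hBne.to_subtype
    have hbaire : ∃ k : ℕ, (interior (closure {x : B | (x : ℝ) ∈ D k})).Nonempty := by
      apply nonempty_interior_of_iUnion_of_closed (fun k => isClosed_closure)
      apply eq_univ_of_forall
      intro x
      obtain ⟨j, hj⟩ := cov x x.2.1
      exact mem_iUnion.2 ⟨j, subset_closure hj⟩
    obtain ⟨k, p, hp⟩ := hbaire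
    obtain ⟨U, hU, hUe⟩ := isOpen_induced_iff.1 (isOpen_interior (s := closure {x : B | (x : ℝ) ∈ D k}))
    have hpU : (p : ℝ) ∈ U := by
      have : p ∈ Subtype.val ⁻¹' U := by rw [hUe]; exact hp
      exact this
    have hUc : ∀ y ∈ U ∩ B, y ∈ closure (D k ∩ B) := by
      rintro y ⟨hyU, hyB⟩
      have h1 : (⟨y, hyB⟩ : B) ∈ closure {x : B | (x : ℝ) ∈ D k} := by
        apply interior_subset
        rw [← hUe]
        exact hyU
      rw [closure_subtype] at h1
      refine closure_mono ?_ h1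
      rintro z ⟨w, hw, rfl⟩
      exact ⟨hw, w.2⟩
    have hUJ : U ∩ Ioo t1 t2 ∈ 𝓝 (p : ℝ) :=
      (hU.inter isOpen_Ioo).mem_nhds ⟨hpU, p.2.1⟩
    obtain ⟨i1, i2, hpI, hI⟩ := mem_nhds_iff_exists_Ioo_subset.1 hUJ
    have hIJ : Ioo i1 i2 ⊆ Ioo t1 t2 := fun y hy => (hI hy).2
    have hIc : ∀ y ∈ Ioo i1 i2, y ∈ B → y ∈ closure (D k ∩ B) := fun y hy hyB =>
      hUc y ⟨(hI hy).1, hyB⟩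
    -- if a point of `B` is isolated from the right then it belongs to `D k`
    have hiso : ∀ c a, c ∈ Ioo i1 i2 → c ∈ B → c < a → (∀ y ∈ Ioo c a, y ∉ B) → c ∈ D k := by
      intro c a hc hcB hca hgap
      have hcl := hIc c hc hcB
      by_cases hfr : ∃ᶠ τ in 𝓝[<] c, τ ∈ D k
      · exact P1 k c (hIJ hc) hfr
      · rw [not_frequently] at hfr
        obtain ⟨d, hd, hdd⟩ := mem_nhdsLT_iff_exists_Ioo_subset.1 hfr
        obtain ⟨y, hy1, hy2⟩ := mem_closure_iff.1 hcl (Ioo d a) isOpen_Ioo ⟨hd, hca⟩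
        rcases lt_trichotomy y c with h | h | h
        · exact absurd hy2.1 (hdd ⟨hy1.1, h⟩)
        · rw [← h]; exact hy2.1
        · exact absurd hy2.2 (hgap y ⟨h, hy1.2⟩)
    have hcomp : ∀ c d, c ∈ Ioo i1 i2 → d ∈ Ioo i1 i2 → IsCompact (B ∩ Icc c d) := by
      intro c d hc hd
      have e : B ∩ Icc c d = Icc c d ∩ Oᶜ := by
        ext y
        constructor
        · rintro ⟨h1, h2⟩; exact ⟨h2, h1.2⟩
        · rintro ⟨h1, h2⟩
          exact ⟨⟨hIJ ⟨lt_of_lt_of_le hc.1 h1.1, lt_of_le_of_lt h1.2 hd.2⟩, h2⟩, h1⟩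
      rw [e]
      exact isCompact_Icc.inter_right hOo.isClosed_compl
    -- Claim A
    have hA1 : ∀ s0 ∈ Ioo i1 i2, s0 ∈ D k → s0 ∈ B → ∀ a ∈ B, s0 ≤ a → a < i2 → a ∈ D k := by
      intro s0 hs0 hs0D hs0B a haB hsa hai
      rcases hsa.eq_or_lt with rfl | hsa
      · exact hs0D
      have haI : a ∈ Ioo i1 i2 := ⟨hs0.1.trans hsa, hai⟩
      by_cases hfr : ∃ᶠ τ in 𝓝[<] a, τ ∈ D k
      · exact P1 k a haB.1 hfr
      · rw [not_frequently] at hfr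
        have hfr2 : {τ | τ ∉ D k} ∩ Ioo s0 a ∈ 𝓝[<] a := inter_mem hfr (Ioo_mem_nhdsLT hsa)
        obtain ⟨d', hd', hdd'⟩ := mem_nhdsLT_iff_exists_Ioo_subset.1 hfr2
        set d := max d' s0 with hd
        have hda : d < a := max_lt hd' hsa
        have hdD : ∀ y ∈ Ioo d a, y ∉ D k := fun y hy =>
          (hdd' ⟨lt_of_le_of_lt (le_max_left _ _) hy.1, hy.2⟩).1
        have hsd : s0 ≤ d := le_max_right _ _
        have hdI : d ∈ Ioo i1 i2 := ⟨lt_of_lt_of_le hs0.1 hsd, hda.trans hai⟩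
        have hdB : ∀ y ∈ Ioo d a, y ∉ B := by
          intro y hy hyB
          obtain ⟨z, hz1, hz2⟩ := mem_closure_iff.1
            (hIc y ⟨hdI.1.trans hy.1, hy.2.trans hai⟩ hyB) (Ioo d a) isOpen_Ioo hy
          exact hdD z hz1 hz2.1
        have hX := hcomp s0 d hs0 hdI
        have hXne : (B ∩ Icc s0 d).Nonempty := ⟨s0, hs0B, le_rfl, hsd⟩
        set c := sSup (B ∩ Icc s0 d) with hc
        have hcm : c ∈ B ∩ Icc s0 d := hX.sSup_mem hXne
        have hcI : c ∈ Ioo i1 i2 := ⟨lt_of_lt_of_le hs0.1 hcm.2.1, lt_of_le_of_lt hcm.2.2 hdI.2⟩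
        have hca : c < a := lt_of_le_of_lt hcm.2.2 hda
        have hgap : ∀ y ∈ Ioo c a, y ∉ B := by
          intro y hy hyB
          by_cases hyd : y ≤ d
          · have : y ≤ c := le_csSup hX.bddAbove ⟨hyB, hcm.2.1.trans hy.1.le, hyd⟩
            linarith [hy.1]
          · exact hdB y ⟨not_le.1 hyd, hy.2⟩ hyB
        have hcD := hiso c a hcI hcm.1 hca hgap
        refine P3 k c a (hIJ hcI).1 hca (hIJ haI).2 hcD ?_ ⟨hca.le, le_rfl⟩
        intro y hy
        exact hBmem y (hIJ ⟨hcI.1.trans hy.1, hy.2.trans hai⟩) (hgap y hy)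
    have hA2 : ∀ s0 ∈ Ioo i1 i2, s0 ∈ D k → s0 ∈ B → ∀ t, s0 ≤ t → t < i2 → t ∈ D k := by
      intro s0 hs0 hs0D hs0B t hst hti
      have htI : t ∈ Ioo i1 i2 := ⟨lt_of_lt_of_le hs0.1 hst, hti⟩
      have hX := hcomp s0 t hs0 htI
      have hXne : (B ∩ Icc s0 t).Nonempty := ⟨s0, hs0B, le_rfl, hst⟩
      set c := sSup (B ∩ Icc s0 t) with hc
      have hcm : c ∈ B ∩ Icc s0 t := hX.sSup_mem hXne
      have hcI : c ∈ Ioo i1 i2 := ⟨lt_of_lt_of_le hs0.1 hcm.2.1, lt_of_le_of_lt hcm.2.2 hti⟩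
      have hcD := hA1 s0 hs0 hs0D hs0B c hcm.1 hcm.2.1 hcI.2
      rcases hcm.2.2.eq_or_lt with h | h
      · rw [← h]; exact hcD
      refine P3 k c t (hIJ hcI).1 h (hIJ htI).2 hcD ?_ ⟨h.le, le_rfl⟩
      intro y hy
      refine hBmem y (hIJ ⟨hcI.1.trans hy.1, hy.2.trans hti⟩) ?_
      intro hyB
      have : y ≤ c := le_csSup hX.bddAbove ⟨hyB, hcm.2.1.trans hy.1.le, hy.2.le⟩
      linarith [hy.1]
    obtain ⟨s0, hs0I, hs0D, hs0B⟩ := mem_closure_iff.1 (hIc p hpI p.2) _ isOpen_Ioo hpI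
    have hA3 : ∀ s0 ∈ Ioo i1 i2, s0 ∈ D k → s0 ∈ B → ∀ t, s0 < t → t < i2 → t ∈ O := by
      intro s0 hs0 hs0D hs0B t hst hti
      refine mem_iUnion.2 ⟨k, ?_⟩
      refine mem_interior.2 ⟨Ioo s0 i2, ?_, isOpen_Ioo, hst, hti⟩
      intro y hy
      exact hA2 s0 hs0 hs0D hs0B y hy.1.le hy.2
    have hleft : Ioo i1 s0 ⊆ O := by
      intro y hy
      refine hBmem y (hIJ ⟨hy.1, hy.2.trans hs0I.2⟩) ?_
      intro hyB
      obtain ⟨z, hz1, hz2⟩ := mem_closure_iff.1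
        (hIc y ⟨hy.1, hy.2.trans hs0I.2⟩ hyB) (Ioo i1 s0) isOpen_Ioo hy
      exact hs0B.2 (hA3 z ⟨hz1.1, hz1.2.trans hs0I.2⟩ hz2.1 hz2.2 s0 hz1.2 hs0I.2)
    obtain ⟨s, hs⟩ := exists_between hs0I.1
    have hsJ : s ∈ Ioo t1 t2 := hIJ ⟨hs.1, hs.2.trans hs0I.2⟩
    obtain ⟨k', hk'⟩ := cov s hsJ
    have h1 := P3 (max k k') s s0 hsJ.1 hs.2 (hIJ hs0I).2 (mono (le_max_right _ _) hk')
      (fun y hy => hleft ⟨hs.1.trans hy.1, hy.2⟩)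
    apply hs0B.2
    refine mem_iUnion.2 ⟨max k k', ?_⟩
    refine mem_interior.2 ⟨Ioo s i2, ?_, isOpen_Ioo, hs.2, hs0I.2⟩
    intro y hy
    rcases le_total y s0 with h | h
    · exact h1 ⟨hy.1.le, h⟩
    · exact mono (le_max_left _ _) (hA2 s0 hs0I hs0D hs0B y h hy.2)
  intro j s t hs hst ht hsD
  rcases hst.eq_or_lt with rfl | hst
  · exact hsD
  refine P3 j s t hs hst ht hsD ?_ ⟨hst.le, le_rfl⟩
  intro y hy
  refine hBmem y ⟨hs.trans hy.1, hy.2.trans ht⟩ fun h => hBempty ⟨y, h⟩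

lemma ptwise_bdd {b : ℝ} {f g : ℝ → ℝ} {v : ℝ × ℝ → ℝ} (S : SP b f g v) (t : ℝ)
    (ht : 0 < t) : ∃ n : ℕ, ∀ x ∈ Ioo (-b) b, -(n:ℝ) ≤ v (x, t) := by
  obtain ⟨a1, ha1, h1⟩ := mem_nhdsGT_iff_exists_Ioo_subset.1 ((S.bcL t ht).eventually_ge_atTop 0)
  obtain ⟨a2, ha2, h2⟩ := mem_nhdsLT_iff_exists_Ioo_subset.1 ((S.bcR t ht).eventually_ge_atTop 0)
  have ha1' : -b < a1 := ha1
  have ha2' : a2 < b := ha2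
  have hK : IsCompact (Icc a1 a2 ×ˢ ({t} : Set ℝ)) := isCompact_Icc.prod isCompact_singleton
  have hl : LowerSemicontinuousOn v (Icc a1 a2 ×ˢ ({t} : Set ℝ)) := by
    apply S.lsc.mono
    rintro ⟨x, τ⟩ ⟨hx, hτ⟩
    have : τ = t := hτ
    refine ⟨⟨lt_of_lt_of_le ha1' hx.1, lt_of_le_of_lt hx.2 ha2'⟩, ?_⟩
    show 0 < τ
    rw [this]; exact ht
  obtain ⟨m, hm⟩ := hl.bddBelow_of_isCompact hK
  obtain ⟨n, hn⟩ := exists_nat_ge (-m)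
  refine ⟨n, fun x hx => ?_⟩
  have hn0 : (0:ℝ) ≤ n := Nat.cast_nonneg n
  by_cases c1 : x < a1
  · have : 0 ≤ v (x, t) := h1 ⟨hx.1, c1⟩
    linarith
  by_cases c2 : a2 < x
  · have : 0 ≤ v (x, t) := h2 ⟨c2, hx.2⟩
    linarith
  have : m ≤ v (x, t) := hm ⟨(x, t), ⟨⟨not_lt.1 c1, not_lt.1 c2⟩, rfl⟩, rfl⟩
  linarith

lemma stage1 {b : ℝ} {f g : ℝ → ℝ} {v : ℝ × ℝ → ℝ} (S : SP b f g v) (hf0 : f 0 = 0) :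
    ∃ t1 t2 : ℝ, ∃ n : ℕ, 0 < t1 ∧ t1 < t2 ∧
      ∀ t ∈ Ioo t1 t2, ∀ x ∈ Ioo (-b) b, -(n:ℝ) ≤ v (x, t) := by
  set E : ℕ → Set ℝ := fun n => {y | ∀ x ∈ Ioo (-b) b, -(n:ℝ) ≤ v (x, Real.exp y)} with hE
  have hb : ∃ n, (interior (closure (E n))).Nonempty := by
    apply nonempty_interior_of_iUnion_of_closed (fun k => isClosed_closure)
    apply eq_univ_of_forall
    intro y
    obtain ⟨n, hn⟩ := ptwise_bdd S (Real.exp y) (Real.exp_pos y)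
    exact mem_iUnion.2 ⟨n, subset_closure hn⟩
  obtain ⟨n, p, hp⟩ := hb
  obtain ⟨a1, a2, hpa, hI⟩ := mem_nhds_iff_exists_Ioo_subset.1 (isOpen_interior.mem_nhds hp)
  refine ⟨Real.exp a1, Real.exp a2, n, Real.exp_pos _, Real.exp_lt_exp.2 (hpa.1.trans hpa.2), ?_⟩
  intro t ht x hx
  have ht0 : 0 < t := (Real.exp_pos a1).trans ht.1
  have := closed_left S hf0 (-(n:ℝ)) 0 t ht0 ?_ x hx
  · linarith
  · rw [frequently_iff]
    intro U hU
    have hU2 := inter_mem hU (Ioo_mem_nhdsLT ht.1)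
    obtain ⟨d', hd', hdd'⟩ := mem_nhdsLT_iff_exists_Ioo_subset.1 hU2
    set d := max d' (Real.exp a1) with hd
    have hdt : d < t := max_lt hd' ht.1
    have hd0 : 0 < d := lt_of_lt_of_le (Real.exp_pos _) (le_max_right _ _)
    have hdl : Real.log d < Real.log t := Real.log_lt_log hd0 hdt
    obtain ⟨y, hy⟩ := exists_between hdl
    have hya : y ∈ Ioo a1 a2 := by
      constructor
      · refine lt_of_le_of_lt ?_ hy.1
        rw [Real.le_log_iff_exp_le hd0]
        exact le_max_right _ _
      · refine hy.2.trans ?_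
        rw [Real.log_lt_iff_lt_exp ht0]
        exact ht.2
    obtain ⟨z, hz1, hz2⟩ := mem_closure_iff.1 (interior_subset (hI hya)) _ isOpen_Ioo hy
    refine ⟨Real.exp z, ?_, ?_⟩
    · refine (hdd' ⟨?_, ?_⟩).1
      · refine lt_of_le_of_lt (le_max_left _ (Real.exp a1)) ?_
        rw [← hd]
        exact (Real.log_lt_iff_lt_exp hd0).1 hz1.1
      · exact (Real.lt_log_iff_exp_lt ht0).1 hz1.2
    · intro x hx
      have := hz2 x hx
      linarith

lemma near_right {A B : ℝ → ℝ} (hA : Continuous A) (hB : Continuous B) {b : ℝ} (h : A b < B b)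
    {a0 : ℝ} (ha0 : a0 < b) : ∃ a, a0 ≤ a ∧ a < b ∧ ∀ x ∈ Ico a b, A x ≤ B x := by
  have h1 : ∀ᶠ x in 𝓝[<] b, A x < B x :=
    nhdsWithin_le_nhds ((isOpen_lt hA hB).mem_nhds h)
  obtain ⟨d, hd, hdd⟩ := mem_nhdsLT_iff_exists_Ioo_subset.1 h1
  have hd' : d < b := hd
  have hm : max d a0 < b := max_lt hd' ha0
  refine ⟨(max d a0 + b) / 2, by linarith [le_max_right d a0], by linarith, fun x hx => ?_⟩
  have : A x < B x := hdd ⟨by linarith [le_max_left d a0, hx.1], hx.2⟩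
  exact this.le

section removal
variable {g G P : ℝ → ℝ} {r : ℝ}

lemma drop_ge (h : GPdata g G P r) {μ k L : ℝ} (hμ : 0 ≤ μ) (hL : 0 ≤ L) :
    L / 2 * (k - P (G k - μ * L / 2)) ≤ k * L - Phi G P (-μ) k L := by
  have h1 := Phi_le_tangent h (κ := -μ) (k := k) (by linarith) (L / 2)
  have h2 := (Phi_bd_neg h (κ := -μ) (k := k) (by linarith) (z1 := L / 2) (z2 := L) (by linarith)).2
  have e : G k + -μ * (L / 2) = G k - μ * L / 2 := by ring
  rw [e] at h2
  nlinarith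

lemma exists_L (h : GPdata g G P r) {k L0 D : ℝ} (hL0 : 0 < L0) (hD : 0 < D) :
    ∀ᶠ μ in atTop, ∃ L, 0 < L ∧ L ≤ L0 ∧ k * L - Phi G P (-μ) k L = D := by
  filter_upwards [eventually_ge_atTop (0:ℝ),
    eventually_ge_atTop (2 * (G k - G (k - 2 * D / L0)) / L0)] with μ hμ0 hμ
  have h1 := drop_ge h (k := k) hμ0 hL0.le
  have h2 : G k - μ * L0 / 2 ≤ G (k - 2 * D / L0) := by
    rw [div_le_iff₀ hL0] at hμ
    linarith
  have h3 := h.Pm.monotone h2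
  rw [h.PG] at h3
  have h4 : D ≤ L0 / 2 * (k - P (G k - μ * L0 / 2)) := by
    have : L0 / 2 * (2 * D / L0) ≤ L0 / 2 * (k - P (G k - μ * L0 / 2)) :=
      mul_le_mul_of_nonneg_left (by linarith) (by linarith)
    have e : L0 / 2 * (2 * D / L0) = D := by field_simp
    linarith
  have hc : ContinuousOn (fun z => k * z - Phi G P (-μ) k z) (Icc 0 L0) := by
    have := Phi_cont h (-μ) k
    apply Continuous.continuousOn
    fun_prop
  have hiv := intermediate_value_Icc hL0.le hc
  have hDm : D ∈ Icc ((fun z => k * z - Phi G P (-μ) k z) 0)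
      ((fun z => k * z - Phi G P (-μ) k z) L0) := by
    constructor
    · simp [Phi_zero]; exact hD.le
    · exact h4.trans h1
  obtain ⟨L, hL, e⟩ := hiv hDm
  refine ⟨L, ?_, hL.2, e⟩
  rcases hL.1.eq_or_lt with h' | h'
  · exfalso
    rw [← h'] at e
    simp [Phi_zero] at e
    linarith
  · exact h'

set_option maxHeartbeats 2000000 in
lemma step_improve (h : GPdata g G P r) {b : ℝ} {f : ℝ → ℝ} {v : ℝ × ℝ → ℝ} (S : SP b f g v)
    (hfm : StrictMono f) (hfc : Continuous f) (hf0 : f 0 = 0) (hft : Tendsto f atTop atTop)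
    (hfb : Tendsto f atBot atBot) (hb : 0 < b)
    {k N n ε C Cf μ0 σ : ℝ} (hk : 0 < k) (hkN : N + n < 2 * b * k)
    (hε : 0 < ε) (hC : 0 < C)
    (hP : ∀ Y, 0 ≤ Y → P (G k + ε * Y) - k ≤ 1 / 128 * (k - P (G k - Y)) + C)
    (hCf : 0 < Cf) (hμ0 : ∀ μ, μ0 ≤ μ → -f (-μ) ≤ f (Cf * μ))
    (hσ0 : 0 < σ) (hσ1 : σ ≤ 1 / 8) (hσ2 : 8 * Cf * σ ≤ ε)
    {s t : ℝ} (hs : 0 < s)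
    (hn : ∀ τ ∈ Ico s t, ∀ x ∈ Ioo (-b) b, -n ≤ v (x, τ))
    (h0 : ∀ x ∈ Ioo (-b) b, N - k * (b - x) ≤ v (x, s))
    (hlat : ∀ s1 t', s < s1 → s1 ≤ t' → t' < t → ∃ k', ∀ τ ∈ Icc s1 t', ∀ x ∈ Ioo (-b) b,
      N - k' * (b - x) ≤ v (x, τ))
    {M : ℝ} (hM : 0 < M)
    (hvM : ∀ τ ∈ Ioo s t, ∀ x ∈ Ioo (-b) b, N - k * (b - x) - M ≤ v (x, τ)) :
    ∀ τ ∈ Ioo s t, ∀ x ∈ Ioo (-b) b, N - k * (b - x) - (1 - σ / 4) * M ≤ v (x, τ) := by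
  intro τ hτ
  set L0 : ℝ := min b (M / (32 * C)) with hL0
  have hL0p : 0 < L0 := by rw [hL0]; positivity
  have hL0b : L0 < 2 * b := lt_of_le_of_lt (min_le_left _ _) (by linarith)
  have hL0C : 32 * C * L0 ≤ M := by
    have : L0 ≤ M / (32 * C) := min_le_right _ _
    rw [le_div_iff₀ (by positivity)] at this
    linarith
  have hτs : 0 < τ - s := by linarith [hτ.1]
  have hFlim : Tendsto (fun μ => -f (-μ)) atTop atTop :=
    tendsto_neg_atBot_atTop.comp (hfb.comp tendsto_neg_atTop_atBot)
  obtain ⟨μ, ⟨L, hLp, hLL0, hLD⟩, hμp, hμμ0, hF⟩ :=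
    ((exists_L h (k := k) hL0p (D := (1 + σ) * M) (by positivity)).and
      ((eventually_gt_atTop (0:ℝ)).and ((eventually_ge_atTop μ0).and
        (hFlim.eventually_gt_atTop (σ * M / (τ - s)))))).exists
  set F := -f (-μ) with hFdef
  have hF0 : 0 < F := lt_trans (by positivity) hF
  set T := σ * M / F with hT
  have hT0 : 0 < T := by positivity
  have hFT : F * T = σ * M := by rw [hT]; field_simp
  have hTτ : s + T < τ := by
    have : T < τ - s := by
      rw [hT, div_lt_iff₀ hF0]
      rw [div_lt_iff₀ hτs] at hF
      linarith
    linarith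
  have hTt : s + T < t := hTτ.trans hτ.2
  have hfμ : f (-μ) = -F := by rw [hFdef]; ring
  -- left lateral control
  set aL : ℝ := b - (N + n) / k with haL
  have haLb : -b < aL := by
    have : (N + n) / k < 2 * b := by rw [div_lt_iff₀ hk]; linarith
    rw [haL]; linarith
  have hleft : ∀ x ∈ Ioc (-b) aL, N - k * (b - x) ≤ -n := by
    intro x hx
    have h1 : (N + n) / k ≤ b - x := by have := hx.2; rw [haL] at this; linarith
    rw [div_le_iff₀ hk] at h1
    linarith
  -- we may use the left control only for points in `(-b,b)`
  have hleft' : ∃ a, -b < a ∧ ∀ x ∈ Ioc (-b) a, ∀ τ ∈ Ico s t, N - k * (b - x) ≤ v (x, τ) := by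
    refine ⟨min aL 0, lt_min haLb (by linarith), ?_⟩
    intro x hx τ hτ
    have hx0 : x ≤ 0 := hx.2.trans (min_le_right _ _)
    exact (hleft x ⟨hx.1, hx.2.trans (min_le_left _ _)⟩).trans
      (hn τ hτ x ⟨hx.1, by linarith⟩)
  have hvM' : ∀ τ ∈ Ico s t, ∀ x ∈ Ioo (-b) b, N - k * (b - x) - M ≤ v (x, τ) := by
    intro τ hτ x hx
    rcases hτ.1.eq_or_lt with h' | h'
    · rw [← h']; linarith [h0 x hx]
    · exact hvM τ ⟨h', hτ.2⟩ x hx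
  -- step a
  have ha : ∀ z0, L ≤ z0 → z0 < 2 * b → ∀ τ' ∈ Ico s (s + T), ∀ x ∈ Ioo (-b) b,
      N - k * z0 + Phi G P (-μ) k (x - (b - z0)) - F * (τ' - s) ≤ v (x, τ') := by
    intro z0 hz0 hz0b
    have hw := wave_Phi h (-μ) k (N - k * z0) (b - z0)
    have hcmp := comparison_full S hw (c := f (-μ)) le_rfl (s := s) (t := s + T) hs ?_ ?_ ?_
    · intro τ' hτ' x hx
      have := hcmp τ' hτ' x hx
      rw [hfμ] at this
      linarith
    · obtain ⟨a, ha, hh⟩ := hleft'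
      refine ⟨a, ha, fun x hx τ' hτ' => ?_⟩
      have h1 := hh x hx τ' ⟨hτ'.1, hτ'.2.trans hTt⟩
      have h2 := Phi_le_tangent h (κ := -μ) (k := k) (by linarith) (x - (b - z0))
      have h3 : 0 ≤ F * (τ' - s) := mul_nonneg hF0.le (by linarith [hτ'.1])
      rw [hfμ]
      first | linarith | nlinarith
    · have hAb : N - k * z0 + Phi G P (-μ) k (b - (b - z0)) < N - k * (b - b) - M := by
        have e : b - (b - z0) = z0 := by ring
        rw [e]
        have h2 := (Phi_bd_neg h (κ := -μ) (k := k) (by linarith) hz0).2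
        have h3 : P (G k + -μ * L) ≤ k := by
          have := h.Pm.monotone (show G k + -μ * L ≤ G k by nlinarith)
          rwa [h.PG] at this
        have h4 := mul_le_mul_of_nonneg_right h3 (show 0 ≤ z0 - L by linarith)
        first | linarith | nlinarith
      have hcA : Continuous fun x => N - k * z0 + Phi G P (-μ) k (x - (b - z0)) := hw.1.continuous
      obtain ⟨a, ha0, hab, haa⟩ := near_right hcA
        (B := fun x => N - k * (b - x) - M) (by fun_prop) hAb (a0 := 0) hb
      refine ⟨a, hab, fun x hx τ' hτ' => ?_⟩
      have h1 := haa x hx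
      have h2 := hvM' τ' ⟨hτ'.1, hτ'.2.trans hTt⟩ x ⟨by linarith [hx.1], hx.2⟩
      have h3 : 0 ≤ F * (τ' - s) := mul_nonneg hF0.le (by linarith [hτ'.1])
      rw [hfμ]
      beta_reduce at h1
      linarith
    · intro x hx
      have h1 := h0 x hx
      have h2 := Phi_le_tangent h (κ := -μ) (k := k) (by linarith) (x - (b - z0))
      first | linarith | nlinarith
  set R := 4 * σ * L with hR
  have hR0 : 0 < R := by positivity
  have hRL : R ≤ L / 2 := by rw [hR]; first | linarith | nlinarith
  have hL2b : L < 2 * b := lt_of_le_of_lt hLL0 hL0b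
  have ha2 : ∀ τ' ∈ Ico s (s + T), ∀ x ∈ Ioo (-b) b, x ≤ b - R →
      N - k * (b - x) - (1 - 2 * σ) * M ≤ v (x, τ') := by
    intro τ' hτ' x hx hxR
    have hFs : F * (τ' - s) ≤ σ * M := by
      rw [← hFT]
      exact mul_le_mul_of_nonneg_left (by linarith [hτ'.2]) hF0.le
    have hσM : 0 < σ * M := by positivity
    rcases le_total L (b - x) with hz | hz
    · have h1 := ha (b - x) hz (by linarith [hx.1]) τ' hτ' x hx
      have e : x - (b - (b - x)) = 0 := by ring
      rw [e, Phi_zero] at h1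
      first | linarith | nlinarith
    · have h1 := ha L le_rfl hL2b τ' hτ' x hx
      have hy0 : 0 ≤ x - (b - L) := by linarith
      have hyL : x - (b - L) ≤ L - R := by linarith
      have h2 := Phi_chord h (κ := -μ) (k := k) (by linarith) hy0 (show x - (b - L) ≤ L by linarith)
      set y := x - (b - L) with hy
      have e2 : Phi G P (-μ) k L = k * L - (1 + σ) * M := by linarith
      rw [e2] at h2
      have h3 : y * ((1 + σ) * M) ≤ (L - R) * ((1 + σ) * M) :=
        mul_le_mul_of_nonneg_right hyL (by positivity)
      have h4 : L * (k * y - (1 - 4 * σ) * ((1 + σ) * M)) ≤ L * Phi G P (-μ) k y := by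
        rw [hR] at h3
        first | linarith | nlinarith
      have h5 := le_of_mul_le_mul_left h4 hLp
      have e3 : k * (b - x) = k * L - k * y := by rw [hy]; ring
      rw [e3]
      linarith [mul_pos hσM hσ0]
  -- choice of `κ`
  obtain ⟨κ, hκ⟩ : ∃ κ, f κ = F := hfc.surjective hft hfb F
  have hκ0 : 0 < κ := by
    rw [← hfm.lt_iff_lt, hf0, hκ]; exact hF0
  have hκμ : κ ≤ Cf * μ := by
    rw [← hfm.le_iff_le, hκ]; exact hμ0 μ hμμ0
  have hPhiR : Phi G P κ k R - k * R ≤ σ * M / 4 := by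
    have h1 := (Phi_bd_pos h (κ := κ) (k := k) hκ0.le hR0.le).2
    rw [Phi_zero, sub_zero, sub_zero] at h1
    have h2 : κ * R ≤ ε * (μ * L / 2) := by
      have e1 : κ * R ≤ Cf * μ * R := mul_le_mul_of_nonneg_right hκμ hR0.le
      have e2 : 8 * Cf * σ * (μ * L / 2) ≤ ε * (μ * L / 2) :=
        mul_le_mul_of_nonneg_right hσ2 (by positivity)
      rw [hR] at e1 ⊢
      linarith
    have h3 := h.Pm.monotone (show G k + κ * R ≤ G k + ε * (μ * L / 2) by linarith)
    have h4 := hP (μ * L / 2) (by positivity)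
    have h5 := drop_ge h (k := k) hμp.le hLp.le
    rw [hLD] at h5
    set Δ := k - P (G k - μ * L / 2) with hΔ
    have h6 : R * (P (G k + κ * R) - k) ≤ R * (1 / 128 * Δ + C) :=
      mul_le_mul_of_nonneg_left (by linarith) hR0.le
    have h7 : L * Δ ≤ 4 * M := by first | linarith | nlinarith
    have h8 : σ * (L * Δ) ≤ σ * (4 * M) := mul_le_mul_of_nonneg_left h7 hσ0.le
    have h9 : σ * (32 * C * L) ≤ σ * M := by
      apply mul_le_mul_of_nonneg_left _ hσ0.le
      refine le_trans ?_ hL0C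
      exact mul_le_mul_of_nonneg_left hLL0 (by positivity)
    have e : R * (1 / 128 * Δ + C) = σ * (L * Δ) / 32 + σ * (32 * C * L) / 8 := by
      rw [hR]; ring
    first | linarith | nlinarith
  -- step b
  set s1 := s + T / 4 with hs1
  obtain ⟨k', hk'⟩ := hlat s1 (s + T) (by linarith) (by linarith) hTt
  have hb' : ∀ x ∈ Ico (b - R) b, ∀ τ' ∈ Ico s1 (s + T),
      N - M - Phi G P κ k R + Phi G P κ k (x - (b - R)) + F * (τ' - s1) ≤ v (x, τ') := by
    intro x hx
    have hw := wave_Phi h κ k (N - M - Phi G P κ k R) (b - R)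
    have hcA : Continuous fun x => N - M - Phi G P κ k R + Phi G P κ k (x - (b - R)) + σ * M :=
      hw.1.continuous.add continuous_const
    have hAb : N - M - Phi G P κ k R + Phi G P κ k (b - (b - R)) + σ * M < N - k' * (b - b) := by
      have e : b - (b - R) = R := by ring
      rw [e]
      first | linarith | nlinarith
    obtain ⟨x2, hxx2, hx2b, hx2⟩ := near_right hcA
        (B := fun x => N - k' * (b - x)) (by fun_prop) hAb (a0 := x) hx.2
    have hFs : ∀ τ' ∈ Ico s1 (s + T), F * (τ' - s1) ≤ σ * M := by
      intro τ' hτ'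
      rw [← hFT]
      exact mul_le_mul_of_nonneg_left (by linarith [hτ'.2]) hF0.le
    have hRb : -b < b - R := by linarith
    have hcmp := comparison S hw (c := F) hκ.ge (x1 := b - R) (x2 := x2) (s := s1) (t := s + T)
      hRb hx2b (by linarith) ?_ ?_ ?_
    · intro τ' hτ'
      exact hcmp τ' hτ' x ⟨hx.1, hxx2⟩
    · intro τ' hτ'
      have h1 := ha2 τ' ⟨by linarith [hτ'.1], hτ'.2⟩ (b - R) ⟨hRb, by linarith⟩ le_rfl
      have e : b - R - (b - R) = 0 := by ring
      simp only [e, Phi_zero]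
      have h2 := hFs τ' hτ'
      have h3 := Phi_ge_tangent h (κ := κ) (k := k) hκ0.le R
      have : 0 < σ * M := by positivity
      first | linarith | nlinarith
    · intro τ' hτ'
      have h1 := hx2 x2 ⟨le_rfl, hx2b⟩
      have h2 := hk' τ' ⟨hτ'.1, hτ'.2.le⟩ x2 ⟨by linarith [hx.1], hx2b⟩
      have h3 := hFs τ' hτ'
      beta_reduce at h1
      linarith
    · intro y hy
      have hyb : y < b := lt_of_le_of_lt hy.2 hx2b
      have h1 := hvM' s1 ⟨by linarith, by linarith⟩ y ⟨by linarith [hy.1], hyb⟩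
      have h2 := (Phi_bd_pos h (κ := κ) (k := k) hκ0.le (z1 := y - (b - R)) (z2 := R)
        (by linarith)).1
      have h3 : k ≤ P (G k + κ * (y - (b - R))) := by
        have := h.Pm.monotone (show G k ≤ G k + κ * (y - (b - R)) by
          have := mul_nonneg hκ0.le (show 0 ≤ y - (b - R) by linarith [hy.1])
          linarith)
        rwa [h.PG] at this
      have h4 := mul_le_mul_of_nonneg_right h3 (show 0 ≤ R - (y - (b - R)) by linarith)
      first | linarith | nlinarith
  -- at time `τ*`
  set ts := s + 3 * T / 4 with hts
  have hstar : ∀ x ∈ Ioo (-b) b, N - k * (b - x) - (1 - σ / 4) * M ≤ v (x, ts) := by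
    intro x hx
    have hσM : 0 < σ * M := by positivity
    rcases le_total x (b - R) with hxR | hxR
    · have := ha2 ts ⟨by linarith, by linarith⟩ x hx hxR
      first | linarith | nlinarith
    · have h1 := hb' x ⟨hxR, hx.2⟩ ts ⟨by linarith, by linarith⟩
      have e : F * (ts - s1) = σ * M / 2 := by
        rw [← hFT, hts, hs1]; ring
      rw [e] at h1
      have h3 := Phi_ge_tangent h (κ := κ) (k := k) hκ0.le (x - (b - R))
      first | linarith | nlinarith
  have hw := wave_affine g (N - k * b - (1 - σ / 4) * M) k
  obtain ⟨t', ht'⟩ := exists_between hτ.2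
  obtain ⟨k2, hk2⟩ := hlat ts t' (by linarith) (by linarith [ht'.1]) ht'.2
  have hqM : 0 < (1 - σ / 4) * M := mul_pos (by linarith) hM
  have hcmp := comparison_full S hw (c := 0) (by rw [hf0]) (s := ts) (t := t')
    (by linarith) ?_ ?_ ?_
  · intro x hx
    have := hcmp τ ⟨by linarith, ht'.1⟩ x hx
    first | linarith | nlinarith
  · obtain ⟨a, ha, hh⟩ := hleft'
    refine ⟨a, ha, fun x hx τ' hτ' => ?_⟩
    have h1 := hh x hx τ' ⟨by linarith [hτ'.1], hτ'.2.trans ht'.2⟩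
    first | linarith | nlinarith
  · obtain ⟨a, ha0, hab, haa⟩ := near_right (A := fun x => N - k * b - (1 - σ / 4) * M + k * x)
        (B := fun x => N - k2 * (b - x)) (b := b) (by fun_prop) (by fun_prop) (by linarith) (a0 := 0) hb
    refine ⟨a, hab, fun x hx τ' hτ' => ?_⟩
    have h1 := haa x hx
    have h2 := hk2 τ' ⟨hτ'.1, hτ'.2.le⟩ x ⟨by linarith [hx.1], hx.2⟩
    beta_reduce at h1
    linarith
  · intro x hx
    have := hstar x hx
    linarith

end removal

section stage2
variable {g G P : ℝ → ℝ} {r : ℝ}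

lemma removal (h : GPdata g G P r) {b : ℝ} {f : ℝ → ℝ} {v : ℝ × ℝ → ℝ} (S : SP b f g v)
    (hfm : StrictMono f) (hfc : Continuous f) (hf0 : f 0 = 0) (hft : Tendsto f atTop atTop)
    (hfb : Tendsto f atBot atBot) (hb : 0 < b)
    {k N n Cf μ0 : ℝ} (hk : 0 < k) (hkN : N + n < 2 * b * k)
    (hCf : 0 < Cf) (hμ0 : ∀ μ, μ0 ≤ μ → -f (-μ) ≤ f (Cf * μ))
    {s t : ℝ} (hs : 0 < s)
    (hn : ∀ τ ∈ Ico s t, ∀ x ∈ Ioo (-b) b, -n ≤ v (x, τ))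
    (h0 : ∀ x ∈ Ioo (-b) b, N - k * (b - x) ≤ v (x, s))
    (hlat : ∀ s1 t', s < s1 → s1 ≤ t' → t' < t → ∃ k', ∀ τ ∈ Icc s1 t', ∀ x ∈ Ioo (-b) b,
      N - k' * (b - x) ≤ v (x, τ)) :
    ∀ τ ∈ Ioo s t, ∀ x ∈ Ioo (-b) b, N - k * (b - x) ≤ v (x, τ) := by
  obtain ⟨ε, C, hε, hC, hP⟩ := P_cmp h k (1 / 128) (by norm_num)
  set σ := min (1 / 8) (ε / (8 * Cf)) with hσ
  have hσ0 : 0 < σ := by rw [hσ]; positivity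
  have hσ1 : σ ≤ 1 / 8 := min_le_left _ _
  have hσ2 : 8 * Cf * σ ≤ ε := by
    have : σ ≤ ε / (8 * Cf) := min_le_right _ _
    rw [le_div_iff₀ (by positivity)] at this
    linarith
  set M0 := max (N + n) 1 with hM0
  have hM0p : 0 < M0 := lt_of_lt_of_le one_pos (le_max_right _ _)
  have hit : ∀ j : ℕ, ∀ τ ∈ Ioo s t, ∀ x ∈ Ioo (-b) b,
      N - k * (b - x) - (1 - σ / 4) ^ j * M0 ≤ v (x, τ) := by
    intro j
    induction j with
    | zero =>
      intro τ hτ x hx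
      have h1 := hn τ ⟨hτ.1.le, hτ.2⟩ x hx
      have h2 : 0 ≤ k * (b - x) := mul_nonneg hk.le (by linarith [hx.2])
      have h3 : N + n ≤ M0 := le_max_left _ _
      rw [pow_zero]
      linarith
    | succ j ih =>
      have hq : 0 < (1 - σ / 4) ^ j * M0 := mul_pos (pow_pos (by linarith) _) hM0p
      have := step_improve h S hfm hfc hf0 hft hfb hb hk hkN hε hC hP hCf hμ0 hσ0 hσ1 hσ2 hs
        hn h0 hlat hq ih
      intro τ hτ x hx
      have h1 := this τ hτ x hx
      rw [pow_succ]
      linarith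
  intro τ hτ x hx
  have hlim : Tendsto (fun j : ℕ => N - k * (b - x) - (1 - σ / 4) ^ j * M0) atTop
      (𝓝 (N - k * (b - x) - 0 * M0)) :=
    ((tendsto_pow_atTop_nhds_zero_of_lt_one (by linarith) (by linarith)).mul_const M0).const_sub _
  rw [zero_mul, sub_zero] at hlim
  exact le_of_tendsto' hlim fun j => hit j τ hτ x hx

lemma stage2 (h : GPdata g G P r) {b : ℝ} {f : ℝ → ℝ} {v : ℝ × ℝ → ℝ} (S : SP b f g v)
    (hfm : StrictMono f) (hfc : Continuous f) (hf0 : f 0 = 0) (hft : Tendsto f atTop atTop)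
    (hfb : Tendsto f atBot atBot) (hb : 0 < b)
    {n Cf μ0 : ℝ}
    (hCf : 0 < Cf) (hμ0 : ∀ μ, μ0 ≤ μ → -f (-μ) ≤ f (Cf * μ))
    {t1 t2 : ℝ} (ht1 : 0 < t1)
    (hn : ∀ τ ∈ Ioo t1 t2, ∀ x ∈ Ioo (-b) b, -n ≤ v (x, τ)) (N : ℝ) :
    ∀ s ∈ Ioo t1 t2, ∃ k, 0 ≤ k ∧ ∀ t, s ≤ t → t < t2 → ∀ x ∈ Ioo (-b) b,
      N - k * (b - x) ≤ v (x, t) := by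
  set K0 : ℝ := (|N + n| + 1) / (2 * b) with hK0
  have hK0p : 0 < K0 := by rw [hK0]; positivity
  have hK0N : N + n < 2 * b * K0 := by
    have e : 2 * b * K0 = |N + n| + 1 := by rw [hK0]; field_simp
    rw [e]
    linarith [le_abs_self (N + n)]
  set D : ℕ → Set ℝ := fun j => {t | ∀ x ∈ Ioo (-b) b, N - (K0 + j) * (b - x) ≤ v (x, t)} with hD
  have hmono : Monotone D := by
    intro i j hij t ht x hx
    have h1 := ht x hx
    have h2 : (i:ℝ) ≤ j := by exact_mod_cast hij
    have h3 := mul_le_mul_of_nonneg_right h2 (show 0 ≤ b - x by linarith [hx.2])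
    linarith
  have hcov : ∀ t ∈ Ioo t1 t2, ∃ j, t ∈ D j := by
    intro t ht
    obtain ⟨a, ha, hh⟩ := mem_nhdsLT_iff_exists_Ioo_subset.1
      ((S.bcR t (ht1.trans ht.1)).eventually_ge_atTop N)
    have hab : a < b := ha
    obtain ⟨j, hj⟩ := exists_nat_ge ((N + n) / (b - a))
    rw [div_le_iff₀ (by linarith)] at hj
    refine ⟨j, fun x hx => ?_⟩
    have hj0 : (0:ℝ) ≤ j := Nat.cast_nonneg j
    have hbx : 0 ≤ b - x := by linarith [hx.2]
    have hKb := mul_nonneg hK0p.le hbx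
    by_cases hxa : a < x
    · have h1 : N ≤ v (x, t) := hh ⟨hxa, hx.2⟩
      have := mul_nonneg hj0 hbx
      linarith
    · have h1 := hn t ht x hx
      have := mul_le_mul_of_nonneg_left (show b - a ≤ b - x by linarith) hj0
      linarith
  have hkey := baire_prop t1 t2 D hmono hcov ?_ ?_
  · intro s hs
    obtain ⟨j, hj⟩ := hcov s hs
    refine ⟨K0 + j, by positivity, fun t hst ht x hx => ?_⟩
    exact hkey j s t hs.1 hst ht hj x hx
  · intro j t ht hfr x hx
    have := closed_left S hf0 (N - (K0 + j) * b) (K0 + j) t (ht1.trans ht.1)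
      (hfr.mono fun τ hτ y hy => by have := hτ y hy; linarith) x hx
    linarith
  · intro j s t hs hst ht hsD hlat τ hτ x hx
    have hj0 : (0:ℝ) ≤ j := Nat.cast_nonneg j
    refine removal h S hfm hfc hf0 hft hfb hb (k := K0 + j) (N := N) (n := n) (by positivity) ?_
      hCf hμ0 (ht1.trans hs) ?_ hsD ?_ τ hτ x hx
    · have := mul_nonneg hb.le hj0
      linarith
    · intro τ hτ x hx
      exact hn τ ⟨lt_of_lt_of_le hs hτ.1, hτ.2.trans ht⟩ x hx
    · intro s1 t' h1 h2 h3
      obtain ⟨j', hj'⟩ := hlat s1 t' h1 h2 h3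
      exact ⟨K0 + j', fun τ hτ => hj' hτ⟩

lemma GPdata.reflect (h : GPdata g G P r) :
    GPdata (fun p => g (-p)) (fun p => - G (-p)) (fun y => - P (-y)) r where
  r0 := h.r0
  gpos := fun p => h.gpos _
  gc := h.gc.comp continuous_neg
  dG := fun p => by
    have := ((h.dG (-p)).comp p (hasDerivAt_neg p)).neg
    have e : -(g (-p) * -1) = g (-p) := by ring
    rw [e] at this
    exact this
  G0 := by simp [h.G0]
  GP := fun y => by simp [h.GP]
  PG := fun p => by simp [h.PG]
  Gm := fun x y hxy => neg_lt_neg (h.Gm (neg_lt_neg hxy))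
  Pm := fun x y hxy => neg_lt_neg (h.Pm (neg_lt_neg hxy))
  Pc := (h.Pc.comp continuous_neg).neg
  dP := fun y => by
    have := ((h.dP (-y)).comp y (hasDerivAt_neg y)).neg
    have e : -((g (P (-y)))⁻¹ * -1) = (g (- - P (-y)))⁻¹ := by rw [neg_neg]; ring
    rw [e] at this
    exact this
  asym := by
    obtain ⟨c, K, hc, hK, hh⟩ := h.asym
    refine ⟨c, K, hc, hK, fun p hp => ⟨?_, ?_⟩⟩
    · exact (hh p hp).2
    · simpa using (hh p hp).1

end stage2

lemma exists_Cf {f : ℝ → ℝ} {β Cp Cm : ℝ} (hβ : 0 < β) (hCp : 0 < Cp) (hCm : 0 < Cm)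
    (h1 : Tendsto (fun s => |s| ^ (-β) * f s) atTop (𝓝 Cp))
    (h2 : Tendsto (fun s => |s| ^ (-β) * f s) atBot (𝓝 (-Cm))) :
    ∃ Cf μ0 : ℝ, 0 < Cf ∧ ∀ μ, μ0 ≤ μ → -f (-μ) ≤ f (Cf * μ) := by
  have e1 : ∀ᶠ s in atTop, Cp / 2 * s ^ β ≤ f s := by
    filter_upwards [h1.eventually (lt_mem_nhds (show Cp / 2 < Cp by linarith)),
      eventually_gt_atTop (0:ℝ)] with s hs hs0
    rw [abs_of_pos hs0, Real.rpow_neg hs0.le] at hs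
    have hp : 0 < s ^ β := Real.rpow_pos_of_pos hs0 _
    rw [inv_mul_eq_div, lt_div_iff₀ hp] at hs
    exact hs.le
  have e2 : ∀ᶠ μ in atTop, -f (-μ) ≤ 2 * Cm * μ ^ β := by
    filter_upwards [(h2.comp tendsto_neg_atTop_atBot).eventually
      (lt_mem_nhds (show -(2 * Cm) < -Cm by linarith)),
      eventually_gt_atTop (0:ℝ)] with s hs hs0
    simp only [Function.comp] at hs
    rw [abs_neg, abs_of_pos hs0, Real.rpow_neg hs0.le] at hs
    have hp : 0 < s ^ β := Real.rpow_pos_of_pos hs0 _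
    rw [inv_mul_eq_div, lt_div_iff₀ hp] at hs
    linarith
  set Cf : ℝ := (4 * Cm / Cp) ^ (1 / β) with hCf
  have hCf0 : 0 < Cf := by rw [hCf]; positivity
  have hCfβ : Cf ^ β = 4 * Cm / Cp := by
    rw [hCf, ← Real.rpow_mul (by positivity), one_div_mul_cancel hβ.ne', Real.rpow_one]
  have e3 := (tendsto_id.const_mul_atTop hCf0 (β := ℝ) (l := atTop)).eventually e1
  obtain ⟨μ0, hμ0⟩ := eventually_atTop.1 (e2.and (e3.and (eventually_gt_atTop (0:ℝ))))
  refine ⟨Cf, μ0, hCf0, fun μ hμ => ?_⟩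
  obtain ⟨a1, a2, a3⟩ := hμ0 μ hμ
  simp only [id] at a2
  rw [Real.mul_rpow hCf0.le a3.le, hCfβ] at a2
  have : Cp / 2 * (4 * Cm / Cp * μ ^ β) = 2 * Cm * μ ^ β := by field_simp; ring
  linarith

section final
variable {g G P : ℝ → ℝ} {r : ℝ}

lemma P_le_f (h : GPdata g G P r) {b β Cp : ℝ} {f : ℝ → ℝ} (hb : 0 < b) (hβ : 1 / r ≤ β)
    (hCp : 0 < Cp) (hf : ∀ᶠ s in atTop, Cp / 2 * s ^ β ≤ f s) :
    ∃ C : ℝ, 0 < C ∧ ∀ᶠ κ in atTop, P (κ * b) ≤ C * f κ := by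
  obtain ⟨c, K, hc, hK, hh⟩ := h.asym
  have hr := h.r0
  set B := (b + K) / c with hB
  have hB0 : 0 < B := by rw [hB]; positivity
  refine ⟨B ^ (1 / r) * (2 / Cp), by positivity, ?_⟩
  filter_upwards [hf, eventually_ge_atTop (1:ℝ)] with κ hκ hκ1
  have hκ0 : 0 < κ := by linarith
  have hP0 : P 0 = 0 := by
    have := h.PG 0
    rwa [h.G0] at this
  have hp : 0 ≤ P (κ * b) := by
    rw [← hP0]; exact h.Pm.monotone (by positivity)
  have h1 := (hh _ hp).1.1
  rw [h.GP] at h1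
  have h2 : P (κ * b) ^ r ≤ B * κ := by
    have e : B * κ = (b * κ + K * κ) / c := by rw [hB]; ring
    rw [e, le_div_iff₀ hc]
    have := mul_le_mul_of_nonneg_left hκ1 hK.le
    linarith
  have h3 : P (κ * b) ≤ (B * κ) ^ (1 / r) := by
    have := Real.rpow_le_rpow (by positivity) h2 (show 0 ≤ 1 / r by positivity)
    rwa [← Real.rpow_mul hp, mul_one_div_cancel hr.ne', Real.rpow_one] at this
  have h4 : κ ^ (1 / r) ≤ κ ^ β := Real.rpow_le_rpow_of_exponent_le hκ1 hβ
  rw [Real.mul_rpow hB0.le hκ0.le] at h3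
  have h5 : κ ^ β ≤ 2 / Cp * f κ := by
    have : 2 / Cp * (Cp / 2 * κ ^ β) ≤ 2 / Cp * f κ := mul_le_mul_of_nonneg_left hκ (by positivity)
    have e : 2 / Cp * (Cp / 2 * κ ^ β) = κ ^ β := by field_simp
    linarith
  calc P (κ * b) ≤ B ^ (1 / r) * κ ^ (1 / r) := h3
    _ ≤ B ^ (1 / r) * (2 / Cp * f κ) := mul_le_mul_of_nonneg_left (h4.trans h5) (by positivity)
    _ = _ := by ring

lemma final_contra (h : GPdata g G P r) {b β Cp : ℝ} {f : ℝ → ℝ} {v : ℝ × ℝ → ℝ} (S : SP b f g v)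
    (hfm : StrictMono f) (hfc : Continuous f) (hf0 : f 0 = 0) (hft : Tendsto f atTop atTop)
    (hfb : Tendsto f atBot atBot) (hb : 0 < b) {Cf μ0 : ℝ}
    (hCf : 0 < Cf) (hμ0 : ∀ μ, μ0 ≤ μ → -f (-μ) ≤ f (Cf * μ))
    (hβ : 1 / r ≤ β) (hCp : 0 < Cp) (hf : ∀ᶠ s in atTop, Cp / 2 * s ^ β ≤ f s) : False := by
  obtain ⟨t1, t2, n, ht1, ht12, hn⟩ := stage1 S hf0
  have hst2R := stage2 h S hfm hfc hf0 hft hfb hb hCf hμ0 ht1 hn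
  have hst2L := stage2 h.reflect S.reflect hfm hfc hf0 hft hfb hb (n := (n:ℝ)) hCf hμ0 ht1
    (fun τ hτ x hx => hn τ hτ (-x) ⟨by linarith [hx.2], by linarith [hx.1]⟩)
  obtain ⟨s, hs1, hs2⟩ := exists_between ht12
  obtain ⟨t, hst, htt2⟩ := exists_between hs2
  obtain ⟨t', htt', ht't2⟩ := exists_between htt2
  obtain ⟨C1, hC1, hP1⟩ := P_le_f h hb hβ hCp hf
  obtain ⟨C2, hC2, hP2⟩ := P_le_f h.reflect hb hβ hCp hf
  set C := max C1 C2 with hC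
  have hC0 : 0 < C := lt_of_lt_of_le hC1 (le_max_left _ _)
  set ρ := min b ((t - s) / (2 * C)) with hρ
  have hts : 0 < t - s := by linarith
  have hρ0 : 0 < ρ := by rw [hρ]; positivity
  have hρb : ρ ≤ b := min_le_left _ _
  have hρC : ρ * C ≤ (t - s) / 2 := by
    have : ρ ≤ (t - s) / (2 * C) := min_le_right _ _
    rw [le_div_iff₀ (by positivity)] at this
    linarith
  have key : ∀ᶠ κ in atTop, -(n:ℝ) + f κ * ((t - s) / 2) ≤ max (v (b - ρ, t)) (v (-b + ρ, t)) := by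
    filter_upwards [hP1, hP2, eventually_gt_atTop (0:ℝ)] with κ hκ1 hκ2 hκ0
    have hfκ : 0 < f κ := by rw [← hf0]; exact hfm hκ0
    have hP0 : P 0 = 0 := by
      have := h.PG 0
      rwa [h.G0] at this
    set Mκ := max (Phi G P κ 0 b) (Phi G P κ 0 (-b)) with hMκ
    have hle : ∀ x ∈ Icc (-b) b, Phi G P κ 0 x ≤ Mκ := by
      intro x hx
      rcases le_total 0 x with hx0 | hx0
      · refine le_trans ?_ (le_max_left _ _)
        have h1 := (Phi_bd_pos h (κ := κ) (k := 0) hκ0.le hx.2).1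
        have h2 : 0 ≤ P (G 0 + κ * x) := by
          rw [h.G0, zero_add, ← hP0]
          exact h.Pm.monotone (by positivity)
        have := mul_nonneg h2 (show 0 ≤ b - x by linarith [hx.2])
        linarith
      · refine le_trans ?_ (le_max_right _ _)
        have h1 := (Phi_bd_pos h (κ := κ) (k := 0) hκ0.le hx.1).2
        have h2 : P (G 0 + κ * x) ≤ 0 := by
          rw [h.G0, zero_add, ← hP0]
          refine h.Pm.monotone ?_
          exact mul_nonpos_of_nonneg_of_nonpos hκ0.le hx0
        have := mul_nonpos_of_nonpos_of_nonneg h2 (show 0 ≤ x - -b by linarith [hx.1])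
        linarith
    have hw := wave_Phi h κ 0 (-(n:ℝ) - Mκ) 0
    set N : ℝ := -(n:ℝ) + f κ * (t' - s) + 1 with hN
    have hbar : ∀ x ∈ Ioo (-b) b, ∀ τ ∈ Ico s t',
        -(n:ℝ) - Mκ + Phi G P κ 0 (x - 0) + f κ * (τ - s) ≤ N - 1 := by
      intro x hx τ hτ
      have h1 := hle x ⟨hx.1.le, hx.2.le⟩
      have h2 := mul_le_mul_of_nonneg_left (show τ - s ≤ t' - s by linarith [hτ.2]) hfκ.le
      rw [sub_zero, hN]
      linarith
    obtain ⟨kR, hkR0, hkR⟩ := hst2R N s ⟨hs1, hs2⟩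
    obtain ⟨kL, hkL0, hkL⟩ := hst2L N s ⟨hs1, hs2⟩
    have hsmall : ∀ k : ℝ, 0 ≤ k → ∃ d, 0 < d ∧ d ≤ b ∧ k * d ≤ 1 := by
      intro k hk
      refine ⟨min b (1 / (k + 1)), by positivity, min_le_left _ _, ?_⟩
      have h1 : min b (1 / (k + 1)) ≤ 1 / (k + 1) := min_le_right _ _
      have h2 : 0 < min b (1 / (k + 1)) := by positivity
      rw [le_div_iff₀ (by positivity)] at h1
      linarith
    have hcmp := comparison_full S hw (c := f κ) le_rfl (s := s) (t := t') (ht1.trans hs1) ?_ ?_ ?_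
    · have hall : ∀ x ∈ Ioo (-b) b, -(n:ℝ) - Mκ + Phi G P κ 0 x + f κ * (t - s) ≤ v (x, t) := by
        intro x hx
        have := hcmp t ⟨hst.le, htt'⟩ x hx
        rwa [sub_zero] at this
      have hbd : ∀ C' y, C' ≤ C → y ≤ C' * f κ → y * ρ ≤ f κ * ((t - s) / 2) := by
        intro C' y hC' hy
        have h1 : y ≤ C * f κ := hy.trans (mul_le_mul_of_nonneg_right hC' hfκ.le)
        have h2 := mul_le_mul_of_nonneg_right h1 hρ0.le
        have h3 := mul_le_mul_of_nonneg_left hρC hfκ.le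
        linarith
      rcases max_choice (Phi G P κ 0 b) (Phi G P κ 0 (-b)) with hm | hm
      · refine le_trans ?_ (le_max_left _ _)
        have h1 := hall (b - ρ) ⟨by linarith, by linarith⟩
        have h2 := (Phi_bd_pos h (κ := κ) (k := 0) hκ0.le (show b - ρ ≤ b by linarith)).2
        have e : b - (b - ρ) = ρ := by ring
        rw [e, h.G0, zero_add] at h2
        have h3 := hbd C1 _ (le_max_left _ _) hκ1
        rw [hMκ, hm] at h1
        linarith
      · refine le_trans ?_ (le_max_right _ _)
        have h1 := hall (-b + ρ) ⟨by linarith, by linarith⟩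
        have h2 := (Phi_bd_pos h (κ := κ) (k := 0) hκ0.le (show -b ≤ -b + ρ by linarith)).1
        have e : -b + ρ - -b = ρ := by ring
        rw [e, h.G0, zero_add] at h2
        have h3 := hbd C2 _ (le_max_right _ _) hκ2
        have e2 : -(κ * b) = κ * -b := by ring
        rw [e2] at h3
        rw [hMκ, hm] at h1
        linarith
    · obtain ⟨d, hd0, hdb, hd⟩ := hsmall kL hkL0
      refine ⟨-b + d / 2, by linarith, fun x hx τ hτ => ?_⟩
      have hxI : x ∈ Ioo (-b) b := ⟨hx.1, by linarith [hx.2]⟩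
      refine (hbar x hxI τ hτ).trans ?_
      have h1 := hkL τ hτ.1 (hτ.2.trans ht't2) (-x) ⟨by linarith [hxI.2], by linarith [hxI.1]⟩
      simp only [neg_neg] at h1
      have h2 := mul_le_mul_of_nonneg_left (show b - -x ≤ d by linarith [hx.2]) hkL0
      linarith
    · obtain ⟨d, hd0, hdb, hd⟩ := hsmall kR hkR0
      refine ⟨b - d / 2, by linarith, fun x hx τ hτ => ?_⟩
      have hxI : x ∈ Ioo (-b) b := ⟨by linarith [hx.1], hx.2⟩
      refine (hbar x hxI τ hτ).trans ?_
      have h1 := hkR τ hτ.1 (hτ.2.trans ht't2) x hxI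
      have h2 := mul_le_mul_of_nonneg_left (show b - x ≤ d by linarith [hx.1]) hkR0
      linarith
    · intro x hx
      have h1 := hle x ⟨hx.1.le, hx.2.le⟩
      have h2 := hn s ⟨hs1, hs2⟩ x hx
      rw [sub_zero]
      linarith
  have hlim : Tendsto (fun κ => -(n:ℝ) + f κ * ((t - s) / 2)) atTop atTop :=
    tendsto_atTop_add_const_left _ _ (hft.atTop_mul_const (by linarith))
  obtain ⟨κ, h1, h2⟩ := (key.and
    (hlim.eventually_gt_atTop (max (v (b - ρ, t)) (v (-b + ρ, t))))).exists
  linarith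

end final

lemma SP_of_superSol {b : ℝ} {f g : ℝ → ℝ} {v : ℝ × ℝ → ℝ} (h : IsSuperSol b f g v) :
    SP b f g v := by
  obtain ⟨h1, h2, h3⟩ := h
  refine ⟨?_, ?_, fun t ht => (h3 t ht).1, fun t ht => (h3 t ht).2⟩
  · apply h1.mono
    rintro ⟨x, t⟩ ⟨hx, ht⟩
    exact ⟨hx, mem_Ici.2 (le_of_lt (mem_Ioi.1 ht))⟩
  · intro A h hA hh x t hx ht hm
    have key := h2 (fun q => A q.1 + h q.2)
      ((hA.comp contDiff_fst).add (hh.comp contDiff_snd)).contDiffOn (x, t) ⟨hx, ht⟩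
      (hm.on _)
    have e1 : pT (fun q : ℝ × ℝ => A q.1 + h q.2) (x, t) = deriv h t := by
      simp only [pT]
      exact deriv_const_add (A x)
    have e2 : ∀ y τ, pX (fun q : ℝ × ℝ => A q.1 + h q.2) (y, τ) = deriv A y := by
      intro y τ
      simp only [pX]
      exact deriv_add_const (h τ)
    have e3 : pXX (fun q : ℝ × ℝ => A q.1 + h q.2) (x, t) = deriv (deriv A) x := by
      simp only [pXX, e2]
    rw [e1, e2, e3] at key
    linarith

/-- non-existence for `α < 1`, `β ≥ 1/(1-α)` and `u₀` bounded from below. -/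
theorem nonexistence (b α β : ℝ) (f g u0 : ℝ → ℝ)
    (hb : 0 < b) (hf : A1 f) (hf3 : A3 f β) (hg : A2 g α)
    (hα : α < 1) (hβ : 1 / (1 - α) ≤ β)
    (hu0c : ContinuousOn u0 (Ioo (-b) b))
    (hu0b : ∃ m : ℝ, ∀ x ∈ Ioo (-b) b, m ≤ u0 x) :
    ¬ ∃ u : ℝ × ℝ → ℝ, IsVSol b f g u0 u := by
  rintro ⟨u, -, hsup, -⟩
  have S := SP_of_superSol hsup
  obtain ⟨hfc, hfm, hf0, hft, hfb⟩ := hf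
  obtain ⟨hβ0, Cp, Cm, hCp, hCm, hl1, hl2⟩ := hf3
  obtain ⟨hgc, hgp, Cgp, Cgm, hCgp, hCgm, hgl1, hgl2⟩ := hg
  obtain ⟨G, P, h⟩ := exists_GP g α hα hgc hgp Cgp Cgm hCgp hCgm hgl1 hgl2
  obtain ⟨Cf, μ0, hCf, hμ0⟩ := exists_Cf hβ0 hCp hCm hl1 hl2
  have e1 : ∀ᶠ s in atTop, Cp / 2 * s ^ β ≤ f s := by
    filter_upwards [hl1.eventually (lt_mem_nhds (show Cp / 2 < Cp by linarith)),
      eventually_gt_atTop (0:ℝ)] with s hs hs0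
    rw [abs_of_pos hs0, Real.rpow_neg hs0.le] at hs
    have hp : 0 < s ^ β := Real.rpow_pos_of_pos hs0 _
    rw [inv_mul_eq_div, lt_div_iff₀ hp] at hs
    exact hs.le
  exact final_contra h S hfm hfc hf0 hft hfb hb hCf hμ0 hβ hCp e1
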